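/- Fix d ≥ 2, let α_d = d^{d+2} / ((d+2)^{d−1} (d+1)² 2^{d−1}), and let L_d(n) = √(α_d) · (nπ)^{(1−d)/2} · ((d+1)^d)^n be the leading asymptotic term for the diagonal d-dimensional rook walk numbers. Then n · ( a_d(n,…,n)/L_d(n) − 1 ) tends to −(d−1)(d+1)(d³ + 6d² + 18d + 12) / (12 d (d+2)³) as n → ∞. -/

import Mathlib

/-- The set of `d`-dimensional rook walks from the origin to `v`: a walk is a
finite sequence of steps, each step adding a positive integer amount to
exactly one coordinate (a step is recorded as a pair of the chosen coordinate
and the positive amount added). -/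
def RookWalks (d : ℕ) (v : Fin d → ℕ) : Set (List (Fin d × ℕ)) :=
  {L | (∀ s ∈ L, 0 < s.2) ∧
       ∀ i : Fin d, (L.map (fun s => if s.1 = i then s.2 else 0)).sum = v i}

/-- The number of `d`-dimensional rook walks from the origin to `v`. -/
noncomputable def rookWalkCount (d : ℕ) (v : Fin d → ℕ) : ℕ :=
  (RookWalks d v).ncard

open Filter Real

theorem rookWalks_eq_union (d : ℕ) (v : Fin d → ℕ) :
    RookWalks d v = (if v = 0 then {[]} else ∅) ∪
      ⋃ p ∈ (Finset.univ.sigma fun i : Fin d => Finset.range (v i)),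
        List.cons (p.1, v p.1 - p.2) '' RookWalks d (Function.update v p.1 p.2) := by
  ext L
  simp only [Set.mem_union, Set.mem_iUnion, Finset.mem_sigma, Finset.mem_univ, true_and,
    Finset.mem_range, Set.mem_image, exists_prop]
  constructor
  · rintro ⟨hpos, hsum⟩
    cases L with
    | nil =>
      left
      have : v = 0 := by
        funext i
        simpa using (hsum i).symm
      simp [this]
    | cons s L =>
      right
      have hs := hsum s.1
      have hs2 := hpos s (by simp)
      simp only [List.map_cons, List.sum_cons, if_true] at hs
      refine ⟨⟨s.1, v s.1 - s.2⟩, by simp only; omega, L, ⟨fun t ht => hpos t (by simp [ht]), ?_⟩, ?_⟩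
      · intro i
        have hi := hsum i
        simp only [List.map_cons, List.sum_cons] at hi
        by_cases h : i = s.1
        · subst h
          simp only [if_true] at hi
          simp only [Function.update_self]
          omega
        · rw [Function.update_of_ne h]
          rw [if_neg (fun h' => h h'.symm)] at hi
          omega
      · have : v s.1 - (v s.1 - s.2) = s.2 := by omega
        simp only [this]
  · rintro (h | ⟨⟨i, j⟩, hj, L, ⟨hpos, hsum⟩, rfl⟩)
    · split_ifs at h with hv
      · obtain rfl : L = [] := h
        subst hv
        exact ⟨by simp, by simp⟩
      · exact h.elim
    · simp only at hj hsum hpos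
      refine ⟨?_, ?_⟩
      · simp only [List.mem_cons, forall_eq_or_imp]
        exact ⟨by omega, hpos⟩
      · intro k
        have hk := hsum k
        simp only [List.map_cons, List.sum_cons]
        by_cases h : k = i
        · subst h
          simp only [Function.update_self] at hk
          simp only [if_true]
          omega
        · rw [Function.update_of_ne h] at hk
          rw [if_neg (fun h' => h h'.symm)]
          omega

theorem sum_update_lt {d : ℕ} (v : Fin d → ℕ) (i : Fin d) (j : ℕ) (hj : j < v i) :
    ∑ k, Function.update v i j k < ∑ k, v k := by
  refine Finset.sum_lt_sum (fun k _ => ?_) ⟨i, Finset.mem_univ i, by simpa using hj⟩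
  by_cases h : k = i
  · subst h; simpa using hj.le
  · simp [Function.update_of_ne h]

theorem rookWalks_finite (d : ℕ) (v : Fin d → ℕ) : (RookWalks d v).Finite := by
  induction h : ∑ k, v k using Nat.strong_induction_on generalizing v with
  | _ m ih =>
    rw [rookWalks_eq_union]
    refine Set.Finite.union (by split_ifs <;> simp) (Set.Finite.biUnion (Finset.finite_toSet _) ?_)
    rintro ⟨i, j⟩ hp
    simp only [Finset.coe_sigma, Set.mem_sigma_iff, Finset.coe_range, Set.mem_Iio] at hp
    exact (ih _ (h ▸ sum_update_lt v i j hp.2) _ rfl).image _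

theorem rookWalkCount_recurrence (d : ℕ) (v : Fin d → ℕ) :
    rookWalkCount d v = (if v = 0 then 1 else 0) +
      ∑ i, ∑ j ∈ Finset.range (v i), rookWalkCount d (Function.update v i j) := by
  classical
  have hfin := fun w => rookWalks_finite d w
  have hset : (hfin v).toFinset = (if v = 0 then {[]} else ∅) ∪
      (Finset.univ.sigma fun i : Fin d => Finset.range (v i)).biUnion fun p =>
        (hfin (Function.update v p.1 p.2)).toFinset.image (List.cons (p.1, v p.1 - p.2)) := by
    apply Finset.coe_injective
    rw [Set.Finite.coe_toFinset, rookWalks_eq_union]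
    push_cast
    congr 1
    · split_ifs <;> simp
    · simp
  unfold rookWalkCount
  simp only [Set.ncard_eq_toFinset_card _ (hfin _)]
  rw [hset, Finset.card_union_of_disjoint, Finset.card_biUnion, Finset.sum_sigma]
  · congr 1
    · split_ifs <;> simp
    · refine Finset.sum_congr rfl fun i _ => Finset.sum_congr rfl fun j _ => ?_
      exact Finset.card_image_of_injective _ List.cons_injective
  · rintro ⟨i, j⟩ hij ⟨i', j'⟩ hij' hne
    simp only [Finset.mem_coe, Finset.mem_sigma, Finset.mem_univ, Finset.mem_range, true_and] at hij hij'
    refine Finset.disjoint_left.2 fun L hL hL' => ?_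
    simp only [Finset.mem_image] at hL hL'
    obtain ⟨L₁, -, rfl⟩ := hL
    obtain ⟨L₂, -, h⟩ := hL'
    simp only [List.cons.injEq, Prod.mk.injEq] at h
    obtain ⟨⟨rfl, h⟩, -⟩ := h
    exact hne (by congr 1; omega)
  · rw [Finset.disjoint_left]
    intro L hL hL'
    simp only [Finset.mem_biUnion, Finset.mem_image] at hL'
    obtain ⟨p, -, L', -, rfl⟩ := hL'
    split_ifs at hL <;> simp at hL

open Polynomial in
/-- The antiderivative of a real polynomial that vanishes at `0`. -/
noncomputable def polyPrimitive (p : ℝ[X]) : ℝ[X] :=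
  p.sum fun k a => monomial (k + 1) (a / (k + 1))

theorem derivative_polyPrimitive (p : Polynomial ℝ) :
    Polynomial.derivative (polyPrimitive p) = p := by
  conv_rhs => rw [← Polynomial.sum_monomial_eq p]
  unfold polyPrimitive Polynomial.sum
  rw [Polynomial.derivative_sum]
  refine Finset.sum_congr rfl fun k _ => ?_
  rw [Polynomial.derivative_monomial]
  push_cast
  congr 1
  field_simp

theorem eval_zero_polyPrimitive (p : Polynomial ℝ) : (polyPrimitive p).eval 0 = 0 := by
  simp [polyPrimitive, Polynomial.sum, Polynomial.eval_finsetSum]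

/-- The polynomial `∑ₖ c(n, k) tᵏ / k!`, where `c(n, k)` is the number of compositions of `n` into
`k` positive parts; its generating function in `n` is `exp (t x / (1 - x))`. -/
noncomputable def compositionPoly : ℕ → Polynomial ℝ
  | 0 => 1
  | n + 1 => compositionPoly n - Polynomial.C ((compositionPoly n).eval 0) +
      polyPrimitive (compositionPoly n)

theorem derivative_compositionPoly_succ (n : ℕ) :
    Polynomial.derivative (compositionPoly (n + 1)) =
      Polynomial.derivative (compositionPoly n) + compositionPoly n := by
  simp [compositionPoly, derivative_polyPrimitive]

theorem eval_zero_compositionPoly_succ (n : ℕ) : (compositionPoly (n + 1)).eval 0 = 0 := by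
  simp [compositionPoly, eval_zero_polyPrimitive]

theorem derivative_compositionPoly (n : ℕ) :
    Polynomial.derivative (compositionPoly n) = ∑ j ∈ Finset.range n, compositionPoly j := by
  induction n with
  | zero => simp [compositionPoly]
  | succ n ih => rw [derivative_compositionPoly_succ, ih, Finset.sum_range_succ]

theorem integrableOn_exp_neg_mul_poly (p : Polynomial ℝ) :
    MeasureTheory.IntegrableOn (fun t => Real.exp (-t) * p.eval t) (Set.Ioi 0) := by
  induction p using Polynomial.induction_on' with
  | add p q hp hq => exact (hp.add hq).congr_fun (fun t _ => by simp [mul_add]) measurableSet_Ioi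
  | monomial n a =>
    have h := (Real.GammaIntegral_convergent (s := n + 1) (by positivity)).const_mul a
    refine MeasureTheory.IntegrableOn.congr_fun h (fun t _ => ?_) measurableSet_Ioi
    simp
    ring

theorem integral_exp_neg_mul_poly (p : Polynomial ℝ) :
    ∫ t in Set.Ioi (0 : ℝ), Real.exp (-t) * p.eval t =
      p.eval 0 + ∫ t in Set.Ioi (0 : ℝ), Real.exp (-t) * (Polynomial.derivative p).eval t := by
  have hderiv : ∀ t ∈ Set.Ici (0 : ℝ), HasDerivAt (fun t => -(Real.exp (-t) * p.eval t))
      (Real.exp (-t) * p.eval t - Real.exp (-t) * (Polynomial.derivative p).eval t) t := by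
    intro t _
    have h := (((hasDerivAt_neg t).exp).mul (p.hasDerivAt t)).neg
    refine h.congr_deriv ?_
    ring
  have hlim : Tendsto (fun t => -(Real.exp (-t) * p.eval t)) atTop (nhds 0) := by
    have := (Polynomial.tendsto_div_exp_atTop p).neg
    rw [neg_zero] at this
    refine this.congr fun t => ?_
    rw [Real.exp_neg]
    ring
  have h := MeasureTheory.integral_Ioi_of_hasDerivAt_of_tendsto' hderiv
    ((integrableOn_exp_neg_mul_poly p).sub (integrableOn_exp_neg_mul_poly _)) hlim
  rw [MeasureTheory.integral_sub (integrableOn_exp_neg_mul_poly p)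
    (integrableOn_exp_neg_mul_poly _)] at h
  simp at h
  linarith

theorem rookWalkCount_eq_integral (d : ℕ) (v : Fin d → ℕ) :
    (rookWalkCount d v : ℝ) =
      ∫ t in Set.Ioi (0 : ℝ), Real.exp (-t) * (∏ i, compositionPoly (v i)).eval t := by
  induction h : ∑ k, v k using Nat.strong_induction_on generalizing v with
  | _ m ih =>
    rw [rookWalkCount_recurrence, integral_exp_neg_mul_poly]
    have hzero : (∏ i, compositionPoly (v i)).eval 0 = if v = 0 then 1 else 0 := by
      rw [Polynomial.eval_prod]
      split_ifs with hv
      · subst hv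
        simp [compositionPoly]
      · obtain ⟨i, hi⟩ := Function.ne_iff.1 hv
        refine Finset.prod_eq_zero (Finset.mem_univ i) ?_
        obtain ⟨k, hk⟩ := Nat.exists_eq_succ_of_ne_zero hi
        rw [hk]
        exact eval_zero_compositionPoly_succ k
    have hder : Polynomial.derivative (∏ i, compositionPoly (v i)) =
        ∑ i, ∑ j ∈ Finset.range (v i), ∏ k, compositionPoly (Function.update v i j k) := by
      rw [Polynomial.derivative_prod_finset]
      refine Finset.sum_congr rfl fun i _ => ?_
      rw [derivative_compositionPoly, Finset.mul_sum]
      refine Finset.sum_congr rfl fun j _ => ?_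
      rw [← Finset.prod_erase_mul _ _ (Finset.mem_univ i), Function.update_self]
      congr 1
      refine Finset.prod_congr rfl fun k hk => ?_
      rw [Function.update_of_ne (Finset.ne_of_mem_erase hk)]
    have hint := fun i j =>
      integrableOn_exp_neg_mul_poly (∏ k, compositionPoly (Function.update v i j k))
    rw [hzero, hder]
    simp only [Polynomial.eval_finsetSum, Finset.mul_sum]
    rw [MeasureTheory.integral_finsetSum _ fun i _ =>
      MeasureTheory.integrable_finsetSum _ fun j _ => hint i j]
    push_cast
    congr 1
    refine Finset.sum_congr rfl fun i _ => ?_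
    rw [MeasureTheory.integral_finsetSum _ fun j _ => hint i j]
    refine Finset.sum_congr rfl fun j hj => ?_
    exact ih _ (h ▸ sum_update_lt v i j (Finset.mem_range.1 hj)) _ rfl

theorem rookWalkCount_diag_eq_integral (d n : ℕ) :
    (rookWalkCount d (fun _ => n) : ℝ) =
      ∫ t in Set.Ioi (0 : ℝ), Real.exp (-t) * (compositionPoly n).eval t ^ d := by
  simp [rookWalkCount_eq_integral]

theorem hasDerivAt_integral_exp_mul (a b : ℝ) (W U : ℝ → ℂ) (hW : Continuous W)
    (hU : Continuous U) (t : ℝ) :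
    HasDerivAt (fun t : ℝ => ∫ θ in a..b, Complex.exp (t * W θ) * U θ)
      (∫ θ in a..b, W θ * (Complex.exp (t * W θ) * U θ)) t := by
  refine (intervalIntegral.hasDerivAt_integral_of_dominated_loc_of_deriv_le
    (F' := fun (t : ℝ) θ => W θ * (Complex.exp (t * W θ) * U θ))
    (bound := fun θ => ‖W θ‖ * (Real.exp ((|t| + 1) * ‖W θ‖) * ‖U θ‖))
    (Metric.ball_mem_nhds t one_pos) (Eventually.of_forall fun x => ?_) ?_ ?_ ?_ ?_ ?_).2
  · exact Continuous.aestronglyMeasurable (by fun_prop)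
  · exact Continuous.intervalIntegrable (by fun_prop) _ _
  · exact Continuous.aestronglyMeasurable (by fun_prop)
  · refine Eventually.of_forall fun θ _ x hx => ?_
    rw [norm_mul, norm_mul]
    have hx' : |x| ≤ |t| + 1 := by
      rw [Metric.mem_ball, Real.dist_eq] at hx
      have := abs_sub_abs_le_abs_sub x t
      linarith
    gcongr
    rw [Complex.norm_exp, Real.exp_le_exp]
    calc (x * W θ).re ≤ ‖x * W θ‖ := Complex.re_le_norm _
      _ = |x| * ‖W θ‖ := by simp
      _ ≤ _ := by gcongr
  · exact Continuous.intervalIntegrable (by fun_prop) _ _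
  · refine Eventually.of_forall fun θ _ x _ => ?_
    have h : HasDerivAt (fun x : ℝ => (x : ℂ) * W θ) (W θ) x := by
      simpa using (Complex.ofRealCLM.hasDerivAt (x := x)).mul_const (W θ)
    exact ((h.cexp).mul_const (U θ)).congr_deriv (by ring)

theorem one_sub_circleMap_ne_zero {r : ℝ} (hr : 0 < r) (hr1 : r < 1) (θ : ℝ) :
    1 - circleMap 0 r θ ≠ 0 := by
  intro h
  have h1 : ‖circleMap 0 r θ‖ = r := by simp [abs_of_pos hr]
  rw [← sub_eq_zero.1 h] at h1
  simp at h1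
  linarith

/-- Cauchy's coefficient formula for the generating function of `compositionPoly`. -/
theorem compositionPoly_eval_eq_integral (n : ℕ) {r : ℝ} (hr : 0 < r) (hr1 : r < 1) (t : ℝ) :
    (2 * π : ℂ) * (((compositionPoly n).eval t : ℝ) : ℂ) =
      ∫ θ in 0..2 * π, Complex.exp (t * (circleMap 0 r θ / (1 - circleMap 0 r θ))) *
        (circleMap 0 r θ ^ n)⁻¹ := by
  have hx := fun θ => circleMap_ne_center (c := 0) (θ := θ) hr.ne'
  have hx1 := one_sub_circleMap_ne_zero hr hr1
  have hW : Continuous fun θ => circleMap 0 r θ / (1 - circleMap 0 r θ) := by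
    exact (continuous_circleMap 0 r).div (continuous_const.sub (continuous_circleMap 0 r)) hx1
  have hU : ∀ n : ℕ, Continuous fun θ => (circleMap 0 r θ ^ n)⁻¹ := fun n =>
    ((continuous_circleMap 0 r).pow n).inv₀ fun θ => pow_ne_zero _ (hx θ)
  induction n generalizing t with
  | zero =>
    have hd : ∀ z ∈ Metric.closedBall (0 : ℂ) |r|,
        DifferentiableAt ℂ (fun z : ℂ => Complex.exp (t * (z / (1 - z)))) z := by
      intro z hz
      have : 1 - z ≠ 0 := by
        intro h
        rw [← sub_eq_zero.1 h, abs_of_pos hr] at hz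
        simp at hz
        linarith
      fun_prop (disch := assumption)
    have h := circleAverage_of_differentiable_on_off_countable (s := ∅) (c := (0 : ℂ)) (R := r)
      (f := fun z : ℂ => Complex.exp (t * (z / (1 - z)))) Set.countable_empty
      (fun z hz => (hd z hz).continuousAt.continuousWithinAt)
      (fun z hz => hd z (Metric.ball_subset_closedBall hz.1))
    rw [circleAverage_def] at h
    simp only [compositionPoly, pow_zero, inv_one, mul_one]
    simp at h
    simp
    have hpi : (π : ℂ) ≠ 0 := by simp [Real.pi_ne_zero]
    field_simp at h
    simp only [mul_div_assoc] at h
    rw [mul_comm, h]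
  | succ n ih =>
    set c := fun (n : ℕ) (t : ℝ) => ∫ θ in 0..2 * π,
      Complex.exp (t * (circleMap 0 r θ / (1 - circleMap 0 r θ))) * (circleMap 0 r θ ^ n)⁻¹ with hc
    have hcd := fun n t => hasDerivAt_integral_exp_mul 0 (2 * π) _ _ hW (hU n) t
    have hpd : ∀ n (t : ℝ), HasDerivAt
        (fun t : ℝ => (2 * π : ℂ) * (((compositionPoly n).eval t : ℝ) : ℂ))
        ((2 * π : ℂ) * (((Polynomial.derivative (compositionPoly n)).eval t : ℝ) : ℂ)) t :=
      fun n t => (((compositionPoly n).hasDerivAt t).ofReal_comp).const_mul _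
    have hrel : ∀ t : ℝ, (∫ θ in 0..2 * π, (circleMap 0 r θ / (1 - circleMap 0 r θ)) *
          (Complex.exp (t * (circleMap 0 r θ / (1 - circleMap 0 r θ))) *
            (circleMap 0 r θ ^ (n + 1))⁻¹)) =
        (∫ θ in 0..2 * π, (circleMap 0 r θ / (1 - circleMap 0 r θ)) *
          (Complex.exp (t * (circleMap 0 r θ / (1 - circleMap 0 r θ))) *
            (circleMap 0 r θ ^ n)⁻¹)) + c n t := by
      intro t
      rw [hc, ← intervalIntegral.integral_add]
      · refine intervalIntegral.integral_congr fun θ _ => ?_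
        have := hx θ
        have := hx1 θ
        field_simp
        ring
      · exact (hW.mul ((Complex.continuous_exp.comp (continuous_const.mul hW)).mul
          (hU n))).intervalIntegrable _ _
      · exact ((Complex.continuous_exp.comp (continuous_const.mul hW)).mul
          (hU n)).intervalIntegrable _ _
    have hdn : ∀ t : ℝ, (2 * π : ℂ) *
        (((Polynomial.derivative (compositionPoly n)).eval t : ℝ) : ℂ) =
        (∫ θ in 0..2 * π, (circleMap 0 r θ / (1 - circleMap 0 r θ)) *
          (Complex.exp (t * (circleMap 0 r θ / (1 - circleMap 0 r θ))) *
            (circleMap 0 r θ ^ n)⁻¹)) := by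
      intro t
      have h := hpd n t
      rw [funext ih] at h
      exact h.unique (hcd n t)
    have hzero : c (n + 1) 0 = 0 := by
      have h := circleIntegral.integral_sub_zpow_of_ne (n := -((n : ℤ) + 2)) (by omega) 0 0 r
      simp only [circleIntegral, deriv_circleMap, sub_zero, smul_eq_mul] at h
      have h2 : ∀ θ, circleMap 0 r θ * Complex.I * circleMap 0 r θ ^ (-((n : ℤ) + 2)) =
          Complex.I * (circleMap 0 r θ ^ (n + 1))⁻¹ := by
        intro θ
        have h0 := hx θ
        rw [zpow_neg, show (n : ℤ) + 2 = ((n + 2 : ℕ) : ℤ) by push_cast; ring, zpow_natCast]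
        field_simp
        ring
      simp only [h2, intervalIntegral.integral_const_mul, mul_eq_zero, Complex.I_ne_zero,
        false_or] at h
      simpa [hc] using h
    have hdiff : ∀ t, HasDerivAt (fun t : ℝ =>
        (2 * π : ℂ) * (((compositionPoly (n + 1)).eval t : ℝ) : ℂ) - c (n + 1) t) 0 t := by
      intro t
      have h := (hpd (n + 1) t).sub (hcd (n + 1) t)
      refine h.congr_deriv ?_
      rw [hrel, derivative_compositionPoly_succ, Polynomial.eval_add, Complex.ofReal_add, mul_add,
        hdn, ih t]
      simp [hc]
    have h := is_const_of_deriv_eq_zero (fun t => (hdiff t).differentiableAt)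
      (fun t => (hdiff t).deriv) t 0
    simp only [eval_zero_compositionPoly_succ, hzero] at h
    simpa [sub_eq_zero] using h

theorem integrable_pow_mul_exp_neg_mul_sq (m : ℕ) {b : ℝ} (hb : 0 < b) :
    MeasureTheory.Integrable fun y : ℝ => y ^ m * Real.exp (-b * y ^ 2) := by
  have h := integrable_rpow_mul_exp_neg_mul_sq hb (s := m) (by
    have : (0 : ℝ) ≤ m := by positivity
    linarith)
  simpa [Real.rpow_natCast] using h

theorem gaussian_moment_add_two (m : ℕ) :
    ∫ y : ℝ, y ^ (m + 2) * Real.exp (-(1 / 2) * y ^ 2) =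
      (m + 1) * ∫ y : ℝ, y ^ m * Real.exp (-(1 / 2) * y ^ 2) := by
  have hint := fun m => integrable_pow_mul_exp_neg_mul_sq m (b := 1 / 2) (by norm_num)
  have hd : ∀ y : ℝ, HasDerivAt (fun y => y ^ (m + 1) * Real.exp (-(1 / 2) * y ^ 2))
      ((m + 1) * (y ^ m * Real.exp (-(1 / 2) * y ^ 2)) -
        y ^ (m + 2) * Real.exp (-(1 / 2) * y ^ 2)) y := by
    intro y
    have h := (hasDerivAt_pow (m + 1) y).mul (((hasDerivAt_pow 2 y).const_mul (-(1 / 2))).exp)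
    refine h.congr_deriv ?_
    push_cast
    ring
  have h := MeasureTheory.integral_eq_zero_of_hasDerivAt_of_integrable hd
    (((hint m).const_mul _).sub (hint (m + 2))) (hint (m + 1))
  rw [MeasureTheory.integral_sub ((hint m).const_mul _) (hint (m + 2)),
    MeasureTheory.integral_const_mul] at h
  linarith

theorem gaussian_moment_zero :
    ∫ y : ℝ, y ^ 0 * Real.exp (-(1 / 2) * y ^ 2) = √(2 * π) := by
  simp only [pow_zero, one_mul]
  rw [integral_gaussian]
  congr 1
  ring

theorem gaussian_moment_one :
    ∫ y : ℝ, y ^ 1 * Real.exp (-(1 / 2) * y ^ 2) = 0 := by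
  have hint := fun m => integrable_pow_mul_exp_neg_mul_sq m (b := 1 / 2) (by norm_num)
  have hd : ∀ y : ℝ, HasDerivAt (fun y => -(y ^ 0 * Real.exp (-(1 / 2) * y ^ 2)))
      (y ^ 1 * Real.exp (-(1 / 2) * y ^ 2)) y := by
    intro y
    simp only [pow_zero, one_mul]
    refine (((hasDerivAt_pow 2 y).const_mul (-(1 / 2))).exp).neg.congr_deriv ?_
    push_cast
    ring
  exact MeasureTheory.integral_eq_zero_of_hasDerivAt_of_integrable hd (hint 1) (hint 0).neg

theorem integral_ofReal_gaussian_moment (m : ℕ) (z : ℂ) :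
    ∫ y : ℝ, z * ((y : ℂ) ^ m * (Real.exp (-(1 / 2) * y ^ 2) : ℂ)) =
      z * ((∫ y : ℝ, y ^ m * Real.exp (-(1 / 2) * y ^ 2) : ℝ) : ℂ) := by
  rw [MeasureTheory.integral_const_mul, ← integral_complex_ofReal]
  simp

theorem integrable_ofReal_gaussian_moment (m : ℕ) (z : ℂ) :
    MeasureTheory.Integrable
      fun y : ℝ => z * ((y : ℂ) ^ m * (Real.exp (-(1 / 2) * y ^ 2) : ℂ)) := by
  have h := (integrable_pow_mul_exp_neg_mul_sq m (b := 1 / 2) (by norm_num)).ofReal (𝕜 := ℂ)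
  simpa using h.const_mul z

theorem norm_exp_sub_one_sub_le (w : ℂ) :
    ‖Complex.exp w - 1 - w‖ ≤ ‖w‖ ^ 2 * Real.exp ‖w‖ := by
  have h := Complex.norm_exp_sub_sum_le_norm_mul_exp w 2
  simpa [Finset.sum_range_succ, sub_sub] using h

theorem norm_exp_sub_quadratic_le (w : ℂ) :
    ‖Complex.exp w - 1 - w - w ^ 2 / 2‖ ≤ ‖w‖ ^ 3 * Real.exp ‖w‖ := by
  have h := Complex.norm_exp_sub_sum_le_norm_mul_exp w 3
  simpa [Finset.sum_range_succ, sub_sub, add_assoc] using h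

/-- If `√N w → x` with `N → ∞`, then `N (eʷ - 1 - w) → x² / 2`. -/
theorem tendsto_mul_exp_sub_one_sub {ι : Type*} {l : Filter ι} {h : ι → ℝ} {N : ι → ℝ} {W : ι → ℂ}
    {x : ℂ} (hN : ∀ᶠ i in l, N i * h i ^ 2 = 1) (hh : Tendsto h l (nhds 0))
    (hW : Tendsto W l (nhds x)) :
    Tendsto (fun i => (N i : ℂ) * (Complex.exp (h i * W i) - 1 - h i * W i)) l
      (nhds (x ^ 2 / 2)) := by
  have hhc : Tendsto (fun i => (h i : ℂ)) l (nhds 0) := by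
    exact_mod_cast (Complex.continuous_ofReal.tendsto 0).comp hh
  have hw : Tendsto (fun i => (h i : ℂ) * W i) l (nhds 0) := by
    simpa using hhc.mul hW
  have hsmall : Tendsto (fun i => (N i : ℂ) *
      (Complex.exp (h i * W i) - 1 - h i * W i - (h i * W i) ^ 2 / 2)) l (nhds 0) := by
    have hb : Tendsto (fun i => ‖W i‖ ^ 2 * ‖(h i : ℂ) * W i‖ * Real.exp ‖(h i : ℂ) * W i‖) l
        (nhds (‖x‖ ^ 2 * ‖(0 : ℂ)‖ * Real.exp ‖(0 : ℂ)‖)) :=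
      ((hW.norm.pow 2).mul hw.norm).mul ((Real.continuous_exp.tendsto _).comp hw.norm)
    simp only [norm_zero, mul_zero, zero_mul] at hb
    refine squeeze_zero_norm' ?_ hb
    filter_upwards [hN] with i hi
    have hNpos : 0 ≤ N i := by
      by_contra hneg
      nlinarith [sq_nonneg (h i)]
    rw [norm_mul, Complex.norm_real, Real.norm_of_nonneg hNpos]
    calc N i * _ ≤ N i * (‖(h i : ℂ) * W i‖ ^ 3 * Real.exp ‖(h i : ℂ) * W i‖) := by
          gcongr
          exact norm_exp_sub_quadratic_le _
      _ = (N i * |h i| ^ 2) * ‖W i‖ ^ 2 * ‖(h i : ℂ) * W i‖ * Real.exp ‖(h i : ℂ) * W i‖ := by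
          simp only [norm_mul, Complex.norm_real, Real.norm_eq_abs]
          ring
      _ = _ := by rw [sq_abs, hi, one_mul]
  have hmain : Tendsto (fun i => W i ^ 2 / 2) l (nhds (x ^ 2 / 2)) := (hW.pow 2).div_const 2
  have := hsmall.add hmain
  rw [zero_add] at this
  refine this.congr' ?_
  filter_upwards [hN] with i hi
  have hi' : (N i : ℂ) * (h i : ℂ) ^ 2 = 1 := by exact_mod_cast hi
  linear_combination (-(W i) ^ 2 / 2) * hi'

theorem exp_expansion_identity (N h y a b g₀ g₁ g₂ γ R S w E : ℂ) (hN : N * h ^ 2 = 1)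
    (hw : w = h * (a * y ^ 3 + h * (b * y ^ 4 + S))) :
    N * ((g₀ + g₁ * (h * y) + h ^ 2 * (g₂ * y ^ 2 + γ + R)) * E - (g₀ + h * (g₁ * y + g₀ * a * y ^ 3)))
      = (g₂ * y ^ 2 + γ + R) * E + (g₀ + g₁ * (h * y)) * (N * (E - 1 - w)) +
        g₀ * (b * y ^ 4 + S) + g₁ * y * (a * y ^ 3 + h * (b * y ^ 4 + S)) := by
  subst hw
  linear_combination ((g₂ * y ^ 2 + γ + R) * E + g₀ * (b * y ^ 4 + S) +
    g₁ * y * (a * y ^ 3 + h * (b * y ^ 4 + S))) * hN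

theorem norm_exp_expansion_le {N h y δ A : ℝ} {a b g₀ g₁ g₂ γ R S w : ℂ} (hN : N * h ^ 2 = 1)
    (hN0 : 0 ≤ N) (hh : 0 ≤ h) (hw : w = h * (a * y ^ 3 + h * (b * y ^ 4 + S)))
    (ha : ‖a‖ ≤ A) (hδ1 : δ ≤ 1) (hδ : (A + ‖b‖ + 1) * δ ≤ 1 / 4) (hy : h * |y| ≤ δ)
    (hS : ‖S‖ ≤ y ^ 4) (hR : ‖R‖ ≤ y ^ 2 + 1) :
    ‖(g₂ * y ^ 2 + γ + R) * Complex.exp w + (g₀ + g₁ * (h * y)) * (N * (Complex.exp w - 1 - w)) +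
        g₀ * (b * y ^ 4 + S) + g₁ * y * (a * y ^ 3 + h * (b * y ^ 4 + S))‖ ≤
      ((‖γ‖ + 1) + (‖g₂‖ + 1) * y ^ 2 + (‖g₀‖ + ‖g₁‖) * (A + ‖b‖ + 1) * y ^ 4 +
        (‖g₀‖ + ‖g₁‖) * (A + ‖b‖ + 1) ^ 2 * y ^ 6) * Real.exp (y ^ 2 / 4) := by
  set K := A + ‖b‖ + 1 with hK
  set X := |y| with hX
  have hA0 : 0 ≤ A := (norm_nonneg a).trans ha
  have hK0 : 0 ≤ K := by positivity
  have hX0 : 0 ≤ X := abs_nonneg y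
  have hX2 : y ^ 2 = X ^ 2 := (sq_abs y).symm
  have hX4 : y ^ 4 = X ^ 4 := by rw [show (4 : ℕ) = 2 * 2 by rfl, pow_mul, pow_mul, hX2]
  have hX6 : y ^ 6 = X ^ 6 := by rw [show (6 : ℕ) = 2 * 3 by rfl, pow_mul, pow_mul, hX2]
  have hny : ‖(y : ℂ)‖ = X := by simp [hX]
  have hnh : ‖(h : ℂ)‖ = h := by simp [abs_of_nonneg hh]
  have hnN : ‖(N : ℂ)‖ = N := by simp [abs_of_nonneg hN0]
  rw [hX2, hX4, hX6]
  rw [hX4] at hS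
  rw [hX2] at hR
  have hhX : h * X ≤ 1 := hy.trans hδ1
  have hT : ‖b * (y : ℂ) ^ 4 + S‖ ≤ (‖b‖ + 1) * X ^ 4 := by
    refine (norm_add_le _ _).trans ?_
    rw [norm_mul, norm_pow, hny]
    linarith
  have hU : ‖a * (y : ℂ) ^ 3 + h * (b * y ^ 4 + S)‖ ≤ K * X ^ 3 := by
    refine (norm_add_le _ _).trans ?_
    rw [norm_mul, norm_mul, norm_pow, hny, hnh]
    calc ‖a‖ * X ^ 3 + h * ‖b * (y : ℂ) ^ 4 + S‖
        ≤ A * X ^ 3 + h * ((‖b‖ + 1) * X ^ 4) := by gcongr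
      _ = A * X ^ 3 + (h * X) * ((‖b‖ + 1) * X ^ 3) := by ring
      _ ≤ A * X ^ 3 + 1 * ((‖b‖ + 1) * X ^ 3) := by gcongr
      _ = K * X ^ 3 := by rw [hK]; ring
  have hnw : ‖w‖ ≤ h * (K * X ^ 3) := by
    rw [hw, norm_mul, hnh]
    gcongr
  have hnw4 : ‖w‖ ≤ X ^ 2 / 4 := by
    calc ‖w‖ ≤ h * (K * X ^ 3) := hnw
      _ = K * (h * X) * X ^ 2 := by ring
      _ ≤ K * δ * X ^ 2 := by gcongr
      _ ≤ 1 / 4 * X ^ 2 := by gcongr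
      _ = X ^ 2 / 4 := by ring
  set Q := Real.exp (X ^ 2 / 4) with hQ
  have hQ1 : 1 ≤ Q := Real.one_le_exp (by positivity)
  have hE : ‖Complex.exp w‖ ≤ Q := by
    rw [Complex.norm_exp]
    exact Real.exp_le_exp.2 ((Complex.re_le_norm w).trans hnw4)
  have hE2 : ‖Complex.exp w - 1 - w‖ ≤ (h * (K * X ^ 3)) ^ 2 * Q := by
    refine (norm_exp_sub_one_sub_le w).trans ?_
    have := Real.exp_le_exp.2 hnw4
    gcongr
  have h1 : ‖(g₂ * (y : ℂ) ^ 2 + γ + R) * Complex.exp w‖ ≤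
      ((‖γ‖ + 1) + (‖g₂‖ + 1) * X ^ 2) * Q := by
    rw [norm_mul]
    have : ‖g₂ * (y : ℂ) ^ 2 + γ + R‖ ≤ (‖γ‖ + 1) + (‖g₂‖ + 1) * X ^ 2 := by
      refine (norm_add₃_le).trans ?_
      rw [norm_mul, norm_pow, hny]
      linarith
    gcongr
  have h2 : ‖(g₀ + g₁ * (h * y)) * (N * (Complex.exp w - 1 - w))‖ ≤
      (‖g₀‖ + ‖g₁‖) * K ^ 2 * X ^ 6 * Q := by
    rw [norm_mul, norm_mul, hnN]
    have h3 : ‖g₀ + g₁ * ((h : ℂ) * y)‖ ≤ ‖g₀‖ + ‖g₁‖ := by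
      refine (norm_add_le _ _).trans ?_
      rw [norm_mul, norm_mul, hnh, hny]
      nlinarith [norm_nonneg g₁]
    calc _ ≤ (‖g₀‖ + ‖g₁‖) * (N * ((h * (K * X ^ 3)) ^ 2 * Q)) := by gcongr
      _ = (‖g₀‖ + ‖g₁‖) * (N * h ^ 2) * (K ^ 2 * X ^ 6 * Q) := by ring
      _ = _ := by rw [hN]; ring
  have h3 : ‖g₀ * (b * (y : ℂ) ^ 4 + S)‖ ≤ ‖g₀‖ * K * X ^ 4 * Q := by
    rw [norm_mul]
    calc _ ≤ ‖g₀‖ * ((‖b‖ + 1) * X ^ 4) := by gcongr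
      _ ≤ ‖g₀‖ * (K * X ^ 4) := by gcongr; linarith
      _ = ‖g₀‖ * K * X ^ 4 * 1 := by ring
      _ ≤ _ := by gcongr
  have h4 : ‖g₁ * (y : ℂ) * (a * y ^ 3 + h * (b * y ^ 4 + S))‖ ≤ ‖g₁‖ * K * X ^ 4 * Q := by
    rw [norm_mul, norm_mul, hny]
    calc _ ≤ ‖g₁‖ * X * (K * X ^ 3) := by gcongr
      _ = ‖g₁‖ * K * X ^ 4 * 1 := by ring
      _ ≤ _ := by gcongr
  refine (norm_add_le _ _).trans ?_
  refine (add_le_add (norm_add₃_le) h4).trans ?_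
  linarith

/-- Second-order Laplace expansion, along an arbitrary countably generated filter, of integrals of
functions which near `0` have the form `g(θ) exp (N χ(θ))` with
`χ(θ) = -θ²/2 + a θ³ + b θ⁴ + o(θ⁴)` and `g(θ) = g₀ + g₁ θ + g₂ θ² + γ/N + o(θ² + 1/N)`. -/
theorem tendsto_laplace_second_order {ι : Type*} {l : Filter ι} [l.IsCountablyGenerated]
    {N : ι → ℝ} (hN : Tendsto N l atTop) {F g χ : ι → ℝ → ℂ} {a : ι → ℂ} {a₀ b g₀ g₁ g₂ γ : ℂ}
    (ha : Tendsto a l (nhds a₀))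
    (hF : ∀ i, Measurable (F i))
    (hFeq : ∀ᶠ p in l ×ˢ nhds (0 : ℝ),
      F p.1 p.2 = g p.1 p.2 * Complex.exp (N p.1 * χ p.1 p.2))
    (hχ : (fun p : ι × ℝ => χ p.1 p.2 - (-(p.2 : ℂ) ^ 2 / 2 + a p.1 * p.2 ^ 3 + b * p.2 ^ 4))
      =o[l ×ˢ nhds (0 : ℝ)] fun p => p.2 ^ 4)
    (hg : (fun p : ι × ℝ => g p.1 p.2 - (g₀ + g₁ * p.2 + g₂ * p.2 ^ 2 + γ / N p.1))
      =o[l ×ˢ nhds (0 : ℝ)] fun p => p.2 ^ 2 + (N p.1)⁻¹)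
    {G c : ℝ} {k : ℕ} (hc : 0 < c)
    (hbound : ∀ᶠ i in l, ∀ θ, ‖F i θ‖ ≤ G * N i ^ k * Real.exp (-c * (N i * θ ^ 2))) :
    Tendsto (fun i => (N i : ℂ) * ((√(N i) : ℂ) * (∫ θ, F i θ) - g₀ * (√(2 * π) : ℂ))) l
      (nhds ((√(2 * π) : ℂ) * (g₂ + γ + 3 * g₁ * a₀ + g₀ * (3 * b + 15 / 2 * a₀ ^ 2)))) := by
  set h : ι → ℝ := fun i => (√(N i))⁻¹ with hh_def
  have hNpos : ∀ᶠ i in l, 1 ≤ N i := hN.eventually_ge_atTop 1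
  have hh0 : Tendsto h l (nhds 0) :=
    tendsto_inv_atTop_zero.comp (Real.tendsto_sqrt_atTop.comp hN)
  have hNh : ∀ i, 1 ≤ N i → N i * h i ^ 2 = 1 := by
    intro i hi
    rw [hh_def]
    simp only
    rw [inv_pow, Real.sq_sqrt (by linarith), mul_inv_cancel₀ (by linarith)]
  have hhpos : ∀ i, 1 ≤ N i → 0 < h i := fun i hi =>
    inv_pos.2 (Real.sqrt_pos.2 (by linarith))
  have hhle : ∀ i, 1 ≤ N i → h i ≤ 1 := fun i hi =>
    inv_le_one_of_one_le₀ (Real.one_le_sqrt.2 hi)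
  set S : ι → ℝ → ℂ := fun i y => (N i : ℂ) ^ 2 * (χ i (h i * y) -
    (-((h i * y : ℝ) : ℂ) ^ 2 / 2 + a i * ((h i * y : ℝ) : ℂ) ^ 3 +
      b * ((h i * y : ℝ) : ℂ) ^ 4)) with hS_def
  set R : ι → ℝ → ℂ := fun i y => (N i : ℂ) * (g i (h i * y) -
    (g₀ + g₁ * ((h i * y : ℝ) : ℂ) + g₂ * ((h i * y : ℝ) : ℂ) ^ 2 + γ / N i)) with hR_def
  set w : ι → ℝ → ℂ := fun i y =>
    h i * (a i * y ^ 3 + h i * (b * y ^ 4 + S i y)) with hw_def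
  set D : ι → ℝ → ℂ := fun i y => (N i : ℂ) * (F i (h i * y) -
    (g₀ + h i * (g₁ * y + g₀ * a i * y ^ 3)) * (Real.exp (-(1 / 2) * y ^ 2) : ℂ)) with hD_def
  have hDeq : ∀ i y, 1 ≤ N i →
      F i (h i * y) = g i (h i * y) * Complex.exp (N i * χ i (h i * y)) →
      D i y = ((g₂ * y ^ 2 + γ + R i y) * Complex.exp (w i y) +
        (g₀ + g₁ * (h i * y)) * (N i * (Complex.exp (w i y) - 1 - w i y)) +
        g₀ * (b * y ^ 4 + S i y) + g₁ * y * (a i * y ^ 3 + h i * (b * y ^ 4 + S i y))) *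
          (Real.exp (-(1 / 2) * y ^ 2) : ℂ) := by
    intro i y hi hFi
    have hN1 : (N i : ℂ) * (h i : ℂ) ^ 2 = 1 := by exact_mod_cast hNh i hi
    have hN0 : (N i : ℂ) ≠ 0 := by
      intro h0
      rw [h0] at hN1
      simp at hN1
    rw [← exp_expansion_identity (N i) (h i) y (a i) b g₀ g₁ g₂ γ (R i y) (S i y) (w i y)
      (Complex.exp (w i y)) hN1 rfl]
    have hgi : g i (h i * y) =
        g₀ + g₁ * (h i * y) + (h i : ℂ) ^ 2 * (g₂ * y ^ 2 + γ + R i y) := by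
      have : γ / N i = (h i : ℂ) ^ 2 * γ := by
        rw [div_eq_iff hN0]
        linear_combination (-γ) * hN1
      simp only [hR_def, this]
      push_cast
      linear_combination (-(g i (h i * y) - (g₀ + g₁ * ((h i : ℂ) * y) + g₂ * ((h i : ℂ) * y) ^ 2
        + (h i : ℂ) ^ 2 * γ))) * hN1
    have hχi : (N i : ℂ) * χ i (h i * y) = w i y + ((-(1 / 2) * y ^ 2 : ℝ) : ℂ) := by
      simp only [hw_def, hS_def]
      push_cast
      linear_combination (-(y : ℂ) ^ 2 / 2 + a i * h i * y ^ 3 + b * h i ^ 2 * y ^ 4 -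
        (N i : ℂ) * (χ i (h i * y) - (-((h i : ℂ) * y) ^ 2 / 2 + a i * ((h i : ℂ) * y) ^ 3 +
      b * ((h i : ℂ) * y) ^ 4))) * hN1
    simp only [hD_def]
    rw [hFi, hχi, Complex.exp_add, ← Complex.ofReal_exp, hgi]
    ring
  have hSb : ∀ ε i y, 1 ≤ N i → ‖χ i (h i * y) - (-((h i * y : ℝ) : ℂ) ^ 2 / 2 +
      a i * ((h i * y : ℝ) : ℂ) ^ 3 + b * ((h i * y : ℝ) : ℂ) ^ 4)‖ ≤ ε * ‖(h i * y) ^ 4‖ →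
      ‖S i y‖ ≤ ε * ‖y ^ 4‖ := by
    intro ε i y hi hb
    simp only [hS_def]
    rw [norm_mul, norm_pow, Complex.norm_real, Real.norm_of_nonneg (zero_le_one.trans hi)]
    calc _ ≤ N i ^ 2 * (ε * ‖(h i * y) ^ 4‖) := by gcongr
      _ = (N i * h i ^ 2) ^ 2 * (ε * ‖y ^ 4‖) := by
        rw [norm_pow, norm_mul, norm_pow, Real.norm_of_nonneg (hhpos i hi).le]
        ring
      _ = _ := by rw [hNh i hi]; ring
  have hRb : ∀ ε i y, 1 ≤ N i → ‖g i (h i * y) - (g₀ + g₁ * ((h i * y : ℝ) : ℂ) +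
      g₂ * ((h i * y : ℝ) : ℂ) ^ 2 + γ / N i)‖ ≤ ε * ‖(h i * y) ^ 2 + (N i)⁻¹‖ →
      ‖R i y‖ ≤ ε * ‖y ^ 2 + 1‖ := by
    intro ε i y hi hb
    have hN0 : 0 < N i := by linarith
    simp only [hR_def]
    rw [norm_mul, Complex.norm_real, Real.norm_of_nonneg hN0.le]
    calc _ ≤ N i * (ε * ‖(h i * y) ^ 2 + (N i)⁻¹‖) := by gcongr
      _ = ε * ((N i * h i ^ 2) * y ^ 2 + N i * (N i)⁻¹) := by
        rw [Real.norm_of_nonneg (by positivity)]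
        ring
      _ = _ := by
        rw [hNh i hi, mul_inv_cancel₀ hN0.ne', Real.norm_of_nonneg (by positivity)]
        ring
  have hpair : ∀ y : ℝ, Tendsto (fun i => (i, h i * y)) l (l ×ˢ nhds (0 : ℝ)) := by
    intro y
    refine tendsto_id.prodMk ?_
    simpa using hh0.mul_const y
  have hlim : ∀ y : ℝ, Tendsto (fun i => D i y) l (nhds
      (((g₂ * y ^ 2 + γ) + g₀ * ((a₀ * y ^ 3) ^ 2 / 2) + g₀ * (b * y ^ 4) +
        g₁ * y * (a₀ * y ^ 3)) * (Real.exp (-(1 / 2) * y ^ 2) : ℂ))) := by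
    intro y
    have hS0 : Tendsto (fun i => S i y) l (nhds 0) := by
      have h1 : (fun i => S i y) =o[l] fun _ => y ^ 4 := by
        refine Asymptotics.IsLittleO.of_bound fun ε hε => ?_
        filter_upwards [hNpos, (hpair y).eventually (hχ.def hε)] with i hi hb
        exact hSb ε i y hi hb
      exact (Asymptotics.isLittleO_one_iff ℝ).1
        (h1.trans_isBigO (Asymptotics.isBigO_const_const _ one_ne_zero _))
    have hR0 : Tendsto (fun i => R i y) l (nhds 0) := by
      have h1 : (fun i => R i y) =o[l] fun _ => y ^ 2 + 1 := by
        refine Asymptotics.IsLittleO.of_bound fun ε hε => ?_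
        filter_upwards [hNpos, (hpair y).eventually (hg.def hε)] with i hi hb
        exact hRb ε i y hi hb
      exact (Asymptotics.isLittleO_one_iff ℝ).1
        (h1.trans_isBigO (Asymptotics.isBigO_const_const _ one_ne_zero _))
    have hhc : Tendsto (fun i => (h i : ℂ)) l (nhds 0) := by
      exact_mod_cast (Complex.continuous_ofReal.tendsto 0).comp hh0
    have hT : Tendsto (fun i => b * (y : ℂ) ^ 4 + S i y) l (nhds (b * (y : ℂ) ^ 4)) := by
      simpa using hS0.const_add (b * (y : ℂ) ^ 4)
    have hW : Tendsto (fun i => a i * (y : ℂ) ^ 3 + h i * (b * y ^ 4 + S i y)) l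
        (nhds (a₀ * (y : ℂ) ^ 3)) := by
      simpa using (ha.mul_const ((y : ℂ) ^ 3)).add (hhc.mul hT)
    have hexp2 := tendsto_mul_exp_sub_one_sub (hNpos.mono fun i hi => hNh i hi) hh0 hW
    have hexp : Tendsto (fun i => Complex.exp (w i y)) l (nhds 1) := by
      have h1 : Tendsto (fun i => w i y) l (nhds 0) := by simpa using hhc.mul hW
      have h2 := (Complex.continuous_exp.tendsto 0).comp h1
      rwa [Complex.exp_zero] at h2
    have h1 : Tendsto (fun i => g₂ * (y : ℂ) ^ 2 + γ + R i y) l (nhds (g₂ * (y : ℂ) ^ 2 + γ)) := by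
      simpa using hR0.const_add (g₂ * (y : ℂ) ^ 2 + γ)
    have h2 : Tendsto (fun i => g₀ + g₁ * ((h i : ℂ) * y)) l (nhds g₀) := by
      simpa using ((hhc.mul_const (y : ℂ)).const_mul g₁).const_add g₀
    have h3 := ((((h1.mul hexp).add (h2.mul hexp2)).add (hT.const_mul g₀)).add
      (hW.const_mul (g₁ * y))).mul_const (Real.exp (-(1 / 2) * y ^ 2) : ℂ)
    rw [mul_one] at h3
    refine h3.congr' ?_
    filter_upwards [hNpos, (hpair y).eventually hFeq] with i hi hFi
    exact (hDeq i y hi hFi).symm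
  set A : ℝ := ‖a₀‖ + 1 with hA_def
  have hA : ∀ᶠ i in l, ‖a i‖ ≤ A :=
    (ha.norm.eventually (gt_mem_nhds (lt_add_one ‖a₀‖))).mono fun i hi => hi.le
  obtain ⟨δ, hδ0, hδ1, hδK, hnear⟩ : ∃ δ : ℝ, 0 < δ ∧ δ ≤ 1 ∧ (A + ‖b‖ + 1) * δ ≤ 1 / 4 ∧
      ∀ᶠ i in l, ∀ θ : ℝ, |θ| < δ →
        F i θ = g i θ * Complex.exp (N i * χ i θ) ∧
        ‖χ i θ - (-(θ : ℂ) ^ 2 / 2 + a i * θ ^ 3 + b * θ ^ 4)‖ ≤ 1 * ‖θ ^ 4‖ ∧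
        ‖g i θ - (g₀ + g₁ * θ + g₂ * θ ^ 2 + γ / N i)‖ ≤ 1 * ‖θ ^ 2 + (N i)⁻¹‖ := by
    have hall := (hFeq.and (hχ.def one_pos)).and (hg.def one_pos)
    obtain ⟨p, hp, q, hq, hpq⟩ := eventually_prod_iff.1 hall
    obtain ⟨δ', hδ', hball⟩ := Metric.eventually_nhds_iff.1 hq
    have hK : 0 < A + ‖b‖ + 1 := by positivity
    refine ⟨min (min δ' 1) (1 / 4 / (A + ‖b‖ + 1)), by positivity,
      (min_le_left _ _).trans (min_le_right _ _), ?_, ?_⟩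
    · calc _ ≤ (A + ‖b‖ + 1) * (1 / 4 / (A + ‖b‖ + 1)) := by
            gcongr
            exact min_le_right _ _
        _ = 1 / 4 := by field_simp
    · filter_upwards [hp] with i hi θ hθ
      have h1 := hpq hi (hball (y := θ) (by
        rw [Real.dist_eq, sub_zero]
        exact hθ.trans_le ((min_le_left _ _).trans (min_le_left _ _))))
      exact ⟨h1.1.1, h1.1.2, h1.2⟩
  set B : ℝ → ℝ := fun y =>
    ((‖γ‖ + 1) * (y ^ 0 * Real.exp (-(1 / 4) * y ^ 2)) +
      (‖g₂‖ + 1) * (y ^ 2 * Real.exp (-(1 / 4) * y ^ 2)) +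
      (‖g₀‖ + ‖g₁‖) * (A + ‖b‖ + 1) * (y ^ 4 * Real.exp (-(1 / 4) * y ^ 2)) +
      (‖g₀‖ + ‖g₁‖) * (A + ‖b‖ + 1) ^ 2 * (y ^ 6 * Real.exp (-(1 / 4) * y ^ 2))) +
    (|G| * (δ⁻¹ ^ 2) ^ (k + 1) * (y ^ (2 * (k + 1)) * Real.exp (-c * y ^ 2)) +
      (‖g₀‖ + ‖g₁‖ + ‖g₀‖ * A) * δ⁻¹ ^ 2 * (y ^ 2 * Real.exp (-(1 / 2) * y ^ 2)) +
      ‖g₁‖ * δ⁻¹ ^ 2 * (y ^ 4 * Real.exp (-(1 / 2) * y ^ 2)) +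
      ‖g₀‖ * A * δ⁻¹ ^ 2 * (y ^ 6 * Real.exp (-(1 / 2) * y ^ 2))) with hB_def
  have hBint : MeasureTheory.Integrable B := by
    have h1 := fun m => integrable_pow_mul_exp_neg_mul_sq m (b := 1 / 4) (by norm_num)
    have h2 := fun m => integrable_pow_mul_exp_neg_mul_sq m (b := 1 / 2) (by norm_num)
    have h3 := fun m => integrable_pow_mul_exp_neg_mul_sq m hc
    exact (((((h1 0).const_mul _).add ((h1 2).const_mul _)).add ((h1 4).const_mul _)).add
      ((h1 6).const_mul _)).add (((((h3 _).const_mul _).add ((h2 2).const_mul _)).add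
      ((h2 4).const_mul _)).add ((h2 6).const_mul _))
  have hdom : ∀ᶠ i in l, ∀ y, ‖D i y‖ ≤ B y := by
    filter_upwards [hNpos, hA, hnear, hbound] with i hi hai hni hbi y
    have hN0 : 0 < N i := by linarith
    have hhi := hhpos i hi
    have hA0 : 0 ≤ A := by positivity
    have e2 : Even 2 := even_two
    have e4 : Even 4 := by decide
    have e6 : Even 6 := by decide
    have p2 : 0 ≤ y ^ 2 := e2.pow_nonneg y
    have p4 : 0 ≤ y ^ 4 := e4.pow_nonneg y
    have p6 : 0 ≤ y ^ 6 := e6.pow_nonneg y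
    have pk : 0 ≤ y ^ (2 * (k + 1)) := (even_two_mul _).pow_nonneg y
    rcases lt_or_ge (h i * |y|) δ with hy | hy
    · obtain ⟨hF1, hχ1, hg1⟩ := hni (h i * y) (by rwa [abs_mul, abs_of_pos hhi])
      rw [hDeq i y hi hF1, norm_mul, Complex.norm_real, Real.norm_of_nonneg (Real.exp_pos _).le]
      have hS1 := hSb 1 i y hi hχ1
      have hR1 := hRb 1 i y hi hg1
      rw [one_mul, Real.norm_of_nonneg (by positivity)] at hS1 hR1
      have hle := norm_exp_expansion_le (g₀ := g₀) (g₁ := g₁) (g₂ := g₂) (γ := γ)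
        (hNh i hi) hN0.le hhi.le (hw := rfl) hai hδ1 hδK hy.le hS1 hR1
      refine (mul_le_mul_of_nonneg_right hle (Real.exp_pos _).le).trans ?_
      rw [mul_assoc, ← Real.exp_add, show y ^ 2 / 4 + -(1 / 2) * y ^ 2 = -(1 / 4) * y ^ 2 by ring]
      rw [hB_def]
      simp only
      refine le_add_of_le_of_nonneg (le_of_eq (by ring)) (by positivity)
    · have hNy : N i ≤ δ⁻¹ ^ 2 * y ^ 2 := by
        have h1 : δ ^ 2 ≤ h i ^ 2 * y ^ 2 := by
          rw [← sq_abs y, ← mul_pow]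
          gcongr
        have h2 : N i * δ ^ 2 ≤ y ^ 2 := by
          calc N i * δ ^ 2 ≤ N i * (h i ^ 2 * y ^ 2) := by gcongr
            _ = (N i * h i ^ 2) * y ^ 2 := by ring
            _ = y ^ 2 := by rw [hNh i hi, one_mul]
        rw [inv_pow, inv_mul_eq_div, le_div_iff₀ (by positivity)]
        exact h2
      have hf1 : N i * ‖F i (h i * y)‖ ≤
          |G| * (δ⁻¹ ^ 2) ^ (k + 1) * (y ^ (2 * (k + 1)) * Real.exp (-c * y ^ 2)) := by
        have h1 := hbi (h i * y)
        rw [show N i * (h i * y) ^ 2 = (N i * h i ^ 2) * y ^ 2 by ring, hNh i hi, one_mul] at h1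
        calc _ ≤ N i * (|G| * N i ^ k * Real.exp (-c * y ^ 2)) := by
              refine mul_le_mul_of_nonneg_left (h1.trans ?_) hN0.le
              gcongr
              exact le_abs_self G
          _ = |G| * N i ^ (k + 1) * Real.exp (-c * y ^ 2) := by ring
          _ ≤ |G| * (δ⁻¹ ^ 2 * y ^ 2) ^ (k + 1) * Real.exp (-c * y ^ 2) := by gcongr
          _ = _ := by rw [mul_pow, ← pow_mul y]; ring
      have hy1 : |y| ≤ 1 + y ^ 2 := by nlinarith [sq_abs y, sq_nonneg (|y| - 1)]
      have hy3 : |y| ^ 3 ≤ 1 + y ^ 4 := by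
        have h4 : y ^ 4 = |y| ^ 4 := by rw [← abs_pow, abs_of_nonneg p4]
        rw [h4]
        have := abs_nonneg y
        nlinarith [sq_nonneg (|y| ^ 2 - |y|), sq_nonneg (|y| ^ 2 - 1), sq_nonneg (|y| - 1)]
      have hf2 : ‖g₀ + h i * (g₁ * y + g₀ * a i * (y : ℂ) ^ 3)‖ ≤
          ‖g₀‖ + (‖g₁‖ * (1 + y ^ 2) + ‖g₀‖ * A * (1 + y ^ 4)) := by
        refine (norm_add_le _ _).trans ?_
        rw [norm_mul, Complex.norm_real, Real.norm_of_nonneg hhi.le]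
        have : ‖g₁ * y + g₀ * a i * (y : ℂ) ^ 3‖ ≤
            ‖g₁‖ * (1 + y ^ 2) + ‖g₀‖ * A * (1 + y ^ 4) := by
          refine (norm_add_le _ _).trans ?_
          simp only [norm_mul, norm_pow, Complex.norm_real, Real.norm_eq_abs]
          gcongr
        calc _ ≤ ‖g₀‖ + 1 * (‖g₁‖ * (1 + y ^ 2) + ‖g₀‖ * A * (1 + y ^ 4)) := by
              gcongr
              exact hhle i hi
          _ = _ := by ring
      have hf3 : N i * (‖g₀ + h i * (g₁ * y + g₀ * a i * (y : ℂ) ^ 3)‖ *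
          Real.exp (-(1 / 2) * y ^ 2)) ≤
          (‖g₀‖ + ‖g₁‖ + ‖g₀‖ * A) * δ⁻¹ ^ 2 * (y ^ 2 * Real.exp (-(1 / 2) * y ^ 2)) +
          ‖g₁‖ * δ⁻¹ ^ 2 * (y ^ 4 * Real.exp (-(1 / 2) * y ^ 2)) +
          ‖g₀‖ * A * δ⁻¹ ^ 2 * (y ^ 6 * Real.exp (-(1 / 2) * y ^ 2)) := by
        calc _ ≤ (δ⁻¹ ^ 2 * y ^ 2) * ((‖g₀‖ + (‖g₁‖ * (1 + y ^ 2) + ‖g₀‖ * A * (1 + y ^ 4))) *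
              Real.exp (-(1 / 2) * y ^ 2)) := by gcongr
          _ = _ := by ring
      rw [hB_def, hD_def]
      simp only
      rw [norm_mul, Complex.norm_real, Real.norm_of_nonneg hN0.le]
      refine le_add_of_nonneg_of_le (by positivity) ?_
      calc _ ≤ N i * (‖F i (h i * y)‖ + ‖g₀ + h i * (g₁ * y + g₀ * a i * (y : ℂ) ^ 3)‖ *
            Real.exp (-(1 / 2) * y ^ 2)) := by
            gcongr
            refine (norm_sub_le _ _).trans ?_
            rw [norm_mul, Complex.norm_real, Real.norm_of_nonneg (Real.exp_pos _).le]
        _ ≤ _ := by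
            rw [mul_add]
            linarith
  have hmeas : ∀ i, MeasureTheory.AEStronglyMeasurable (D i) := by
    intro i
    refine Measurable.aestronglyMeasurable ?_
    have h1 : Measurable fun y => F i (h i * y) := (hF i).comp (measurable_const_mul (h i))
    refine (h1.sub (Continuous.measurable ?_)).const_mul _
    fun_prop
  have hconv := MeasureTheory.tendsto_integral_filter_of_dominated_convergence B (Eventually.of_forall hmeas)
    (hdom.mono fun i hi => Eventually.of_forall hi) hBint (Eventually.of_forall hlim)
  have hm2 := gaussian_moment_add_two 0
  have hm4 := gaussian_moment_add_two 2
  have hm6 := gaussian_moment_add_two 4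
  have hm3 := gaussian_moment_add_two 1
  rw [gaussian_moment_zero] at hm2
  rw [gaussian_moment_one] at hm3
  norm_num only at hm2 hm3 hm4 hm6
  have hI := integral_ofReal_gaussian_moment
  have hIint := integrable_ofReal_gaussian_moment
  have hlimint : ∫ y : ℝ, ((g₂ * (y : ℂ) ^ 2 + γ) + g₀ * ((a₀ * y ^ 3) ^ 2 / 2) + g₀ * (b * y ^ 4) +
      g₁ * y * (a₀ * y ^ 3)) * (Real.exp (-(1 / 2) * y ^ 2) : ℂ) =
      (√(2 * π) : ℂ) * (g₂ + γ + 3 * g₁ * a₀ + g₀ * (3 * b + 15 / 2 * a₀ ^ 2)) := by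
    have : ∀ y : ℝ, ((g₂ * (y : ℂ) ^ 2 + γ) + g₀ * ((a₀ * y ^ 3) ^ 2 / 2) + g₀ * (b * y ^ 4) +
        g₁ * y * (a₀ * y ^ 3)) * (Real.exp (-(1 / 2) * y ^ 2) : ℂ) =
        γ * ((y : ℂ) ^ 0 * (Real.exp (-(1 / 2) * y ^ 2) : ℂ)) +
        g₂ * ((y : ℂ) ^ 2 * (Real.exp (-(1 / 2) * y ^ 2) : ℂ)) +
        (g₀ * b + g₁ * a₀) * ((y : ℂ) ^ 4 * (Real.exp (-(1 / 2) * y ^ 2) : ℂ)) +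
        (g₀ * a₀ ^ 2 / 2) * ((y : ℂ) ^ 6 * (Real.exp (-(1 / 2) * y ^ 2) : ℂ)) := fun y => by ring
    simp only [this]
    rw [MeasureTheory.integral_add, MeasureTheory.integral_add, MeasureTheory.integral_add, hI, hI,
      hI, hI, hm6, hm4, hm2, gaussian_moment_zero]
    · push_cast
      ring
    exacts [hIint 0 _, hIint 2 _, (hIint 0 _).add (hIint 2 _), hIint 4 _,
      ((hIint 0 _).add (hIint 2 _)).add (hIint 4 _), hIint 6 _]
  rw [hlimint] at hconv
  refine hconv.congr' ?_
  filter_upwards [hNpos, hdom] with i hi hdi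
  have hN0 : (N i : ℂ) ≠ 0 := by
    rw [Complex.ofReal_ne_zero]
    linarith
  have hP : ∀ y : ℝ, (g₀ + h i * (g₁ * y + g₀ * a i * (y : ℂ) ^ 3)) *
      (Real.exp (-(1 / 2) * y ^ 2) : ℂ) =
      g₀ * ((y : ℂ) ^ 0 * (Real.exp (-(1 / 2) * y ^ 2) : ℂ)) +
      h i * g₁ * ((y : ℂ) ^ 1 * (Real.exp (-(1 / 2) * y ^ 2) : ℂ)) +
      h i * (g₀ * a i) * ((y : ℂ) ^ 3 * (Real.exp (-(1 / 2) * y ^ 2) : ℂ)) := fun y => by ring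
  have hPint : MeasureTheory.Integrable fun y : ℝ => (g₀ + h i * (g₁ * y + g₀ * a i * (y : ℂ) ^ 3)) *
      (Real.exp (-(1 / 2) * y ^ 2) : ℂ) := by
    simp only [hP]
    exact ((hIint 0 _).add (hIint 1 _)).add (hIint 3 _)
  have hPval : ∫ y : ℝ, (g₀ + h i * (g₁ * y + g₀ * a i * (y : ℂ) ^ 3)) *
      (Real.exp (-(1 / 2) * y ^ 2) : ℂ) = g₀ * (√(2 * π) : ℂ) := by
    simp only [hP]
    rw [MeasureTheory.integral_add, MeasureTheory.integral_add, hI, hI, hI, hm3,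
      gaussian_moment_one, gaussian_moment_zero]
    · simp
    exacts [hIint 0 _, hIint 1 _, (hIint 0 _).add (hIint 1 _), hIint 3 _]
  have hDint : MeasureTheory.Integrable (D i) :=
    hBint.mono' (hmeas i) (Eventually.of_forall hdi)
  have hFint : MeasureTheory.Integrable fun y => F i (h i * y) := by
    refine ((hDint.const_mul (N i : ℂ)⁻¹).add hPint).congr (Eventually.of_forall fun y => ?_)
    simp only [hD_def, Pi.add_apply]
    field_simp
    ring
  simp only [hD_def]
  rw [MeasureTheory.integral_const_mul, MeasureTheory.integral_sub hFint hPint, hPval,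
    MeasureTheory.Measure.integral_comp_mul_left, abs_of_pos (inv_pos.2 (hhpos i hi)),
    Complex.real_smul]
  simp [hh_def]

/-- The exponent governing `compositionPoly n` at `n / (ρ (1 + ρ))` on its saddle-point circle. -/
noncomputable def saddleExponent (ρ θ : ℝ) : ℂ :=
  (Complex.exp (θ * Complex.I) - 1) / (1 - ρ * (Complex.exp (θ * Complex.I) - 1)) - θ * Complex.I

theorem one_sub_mul_exp_sub_one_ne_zero {ρ : ℝ} (hρ : 0 < ρ) (θ : ℝ) :
    1 - (ρ : ℂ) * (Complex.exp (θ * Complex.I) - 1) ≠ 0 := by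
  intro h
  have h1 := congrArg Complex.re h
  simp [Complex.exp_ofReal_mul_I_re] at h1
  nlinarith [Real.cos_le_one θ]

theorem re_saddleExponent_le {ρ : ℝ} (hρ : 0 < ρ) (θ : ℝ) :
    (saddleExponent ρ θ).re ≤ -(1 - Real.cos θ) / (1 + 2 * ρ) := by
  have hcs := Real.sin_sq_add_cos_sq θ
  have hc1 := Real.cos_le_one θ
  have hc2 := Real.neg_one_le_cos θ
  have hn : Complex.normSq (1 - (ρ : ℂ) * (Complex.exp (θ * Complex.I) - 1)) =
      1 + 2 * ρ * (1 + ρ) * (1 - Real.cos θ) := by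
    simp [Complex.normSq_apply, Complex.exp_ofReal_mul_I_re, Complex.exp_ofReal_mul_I_im]
    linear_combination ρ ^ 2 * hcs
  have hre : (saddleExponent ρ θ).re =
      -((1 - Real.cos θ) * (1 + 2 * ρ)) / (1 + 2 * ρ * (1 + ρ) * (1 - Real.cos θ)) := by
    rw [saddleExponent, Complex.sub_re, Complex.div_re, hn, ← add_div]
    simp only [Complex.sub_re, Complex.sub_im, Complex.mul_re, Complex.mul_im,
      Complex.exp_ofReal_mul_I_re, Complex.exp_ofReal_mul_I_im, Complex.ofReal_re,
      Complex.ofReal_im, Complex.one_re, Complex.one_im, Complex.I_re, Complex.I_im]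
    ring_nf
    rw [Real.sin_sq]
    ring
  have hu : 0 ≤ 1 - Real.cos θ := by linarith
  rw [hre, div_le_div_iff₀ (by positivity) (by positivity)]
  have : 0 ≤ (1 - Real.cos θ) * (2 * ρ * (1 + ρ) * (1 + Real.cos θ)) := by
    have : 0 ≤ 1 + Real.cos θ := by linarith
    positivity
  nlinarith

theorem norm_exp_mul_saddleExponent_le {ρ : ℝ} (hρ : 0 < ρ) (n : ℕ) {θ : ℝ} (hθ : |θ| ≤ π) :
    ‖Complex.exp (n * saddleExponent ρ θ)‖ ≤
      Real.exp (-(2 / π ^ 2 / (1 + 2 * ρ)) * (n * θ ^ 2)) := by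
  rw [Complex.norm_exp]
  refine Real.exp_le_exp.2 ?_
  have h1 := re_saddleExponent_le hρ θ
  have h2 := Real.cos_le_one_sub_mul_cos_sq hθ
  have h3 : (saddleExponent ρ θ).re ≤ -(2 / π ^ 2 / (1 + 2 * ρ)) * θ ^ 2 := by
    refine h1.trans ?_
    rw [neg_div, neg_mul, neg_le_neg_iff, div_mul_eq_mul_div]
    gcongr
    linarith
  simp only [← Complex.ofReal_natCast, Complex.re_ofReal_mul]
  calc _ ≤ (n : ℝ) * (-(2 / π ^ 2 / (1 + 2 * ρ)) * θ ^ 2) := by gcongr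
    _ = _ := by ring

/-- `compositionPoly n` at `n / (ρ (1 + ρ))`, normalised by its exponential size. -/
noncomputable def normalizedComposition (n : ℕ) (ρ : ℝ) : ℝ :=
  (compositionPoly n).eval (n / (ρ * (1 + ρ))) * (ρ / (1 + ρ)) ^ n * Real.exp (-(n / (1 + ρ)))

theorem normalizedComposition_eq_integral (n : ℕ) {ρ : ℝ} (hρ : 0 < ρ) :
    (2 * π : ℂ) * (normalizedComposition n ρ : ℂ) =
      ∫ θ in -π..π, Complex.exp (n * saddleExponent ρ θ) := by
  have hr : 0 < ρ / (1 + ρ) := by positivity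
  have hr1 : ρ / (1 + ρ) < 1 := (div_lt_one (by positivity)).2 (by linarith)
  have h := compositionPoly_eval_eq_integral n hr hr1 (n / (ρ * (1 + ρ)))
  have hρc : (ρ : ℂ) ≠ 0 := by exact_mod_cast hρ.ne'
  have hρ1 : (1 + ρ : ℂ) ≠ 0 := by exact_mod_cast (by positivity : (1 + ρ : ℝ) ≠ 0)
  have hcirc : ∀ θ : ℝ, circleMap 0 (ρ / (1 + ρ)) θ =
      ρ / (1 + ρ) * Complex.exp (θ * Complex.I) := fun θ => by simp [circleMap]
  set f : ℝ → ℂ := fun θ => Complex.exp (n * saddleExponent ρ θ) with hf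
  have hpt : ∀ θ : ℝ, Complex.exp (((n / (ρ * (1 + ρ)) : ℝ) : ℂ) *
      (circleMap 0 (ρ / (1 + ρ)) θ / (1 - circleMap 0 (ρ / (1 + ρ)) θ))) *
      (circleMap 0 (ρ / (1 + ρ)) θ ^ n)⁻¹ *
      (((ρ / (1 + ρ)) ^ n * Real.exp (-(n / (1 + ρ))) : ℝ) : ℂ) = f θ := by
    intro θ
    have h1 := one_sub_mul_exp_sub_one_ne_zero hρ θ
    have hE := Complex.exp_ne_zero (θ * Complex.I)
    have key : ((n / (ρ * (1 + ρ)) : ℝ) : ℂ) *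
        (circleMap 0 (ρ / (1 + ρ)) θ / (1 - circleMap 0 (ρ / (1 + ρ)) θ)) =
        n * saddleExponent ρ θ + n * (θ * Complex.I) + n / (1 + ρ) := by
      have h2 : 1 - circleMap 0 (ρ / (1 + ρ)) θ =
          (1 - ρ * (Complex.exp (θ * Complex.I) - 1)) / (1 + ρ) := by
        rw [hcirc]
        field_simp
        ring
      rw [h2, hcirc, saddleExponent]
      push_cast
      field_simp
      ring
    rw [key, Complex.exp_add, Complex.exp_add, hcirc, mul_pow, ← Complex.exp_nat_mul]
    push_cast
    rw [Complex.exp_neg]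
    have hE2 := Complex.exp_ne_zero ((n : ℂ) * (θ * Complex.I))
    have hE3 := Complex.exp_ne_zero ((n : ℂ) / (1 + ρ))
    simp only [hf]
    field_simp
  have hper : Function.Periodic f (2 * π) := by
    intro θ
    rw [← hpt, ← hpt, periodic_circleMap 0 (ρ / (1 + ρ)) θ]
  have h2 := hper.intervalIntegral_add_eq (-π) 0
  rw [show -π + 2 * π = π by ring, zero_add] at h2
  rw [h2, normalizedComposition, mul_assoc (Polynomial.eval _ _), Complex.ofReal_mul, ← mul_assoc, h,
    ← intervalIntegral.integral_mul_const]
  exact intervalIntegral.integral_congr fun θ _ => hpt θ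

theorem abs_normalizedComposition_le_one (n : ℕ) {ρ : ℝ} (hρ : 0 < ρ) :
    |normalizedComposition n ρ| ≤ 1 := by
  have h := intervalIntegral.norm_integral_le_of_norm_le_const (a := -π) (b := π) (C := 1)
    (f := fun θ => Complex.exp (n * saddleExponent ρ θ)) fun θ hθ => by
      rw [Set.uIoc_of_le (by linarith [Real.pi_pos])] at hθ
      refine (norm_exp_mul_saddleExponent_le hρ n (abs_le.2 ⟨hθ.1.le, hθ.2⟩)).trans ?_
      rw [Real.exp_le_one_iff, neg_mul, neg_nonpos]
      positivity
  rw [← normalizedComposition_eq_integral n hρ, norm_mul, Complex.norm_real, Real.norm_eq_abs,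
    show π - -π = 2 * π by ring, one_mul, abs_of_pos Real.two_pi_pos] at h
  have h2 : ‖(2 * π : ℂ)‖ = 2 * π := by simp [Real.pi_pos.le]
  rw [h2] at h
  exact le_of_mul_le_mul_left (by linarith) (by positivity : (0 : ℝ) < 2 * π)

/-- The Taylor polynomial of degree four of `exp (iθ) - 1`. -/
theorem exp_mul_I_sub_one_isLittleO :
    (fun θ : ℝ => Complex.exp (θ * Complex.I) - 1 -
      (Complex.I * θ - (θ : ℂ) ^ 2 / 2 - Complex.I * θ ^ 3 / 6 + (θ : ℂ) ^ 4 / 24))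
      =o[nhds 0] fun θ : ℝ => θ ^ 4 := by
  have h := Complex.exp_sub_sum_range_succ_isLittleO_pow 4
  have ht : Tendsto (fun θ : ℝ => (θ : ℂ) * Complex.I) (nhds 0) (nhds 0) := by
    have : Continuous fun θ : ℝ => (θ : ℂ) * Complex.I := by fun_prop
    simpa using this.tendsto 0
  have h2 := h.comp_tendsto ht
  refine Asymptotics.IsLittleO.of_norm_right (((h2.norm_right).congr ?_ ?_))
  · intro θ
    simp only [Function.comp, Finset.sum_range_succ, Finset.sum_range_zero, Nat.factorial,
      mul_pow, Complex.I_sq, Complex.I_pow_three, Complex.I_pow_four]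
    push_cast
    ring
  · intro θ
    simp

theorem pow_five_mul_isLittleO {c : ℝ → ℂ} (hc : Continuous c) :
    (fun θ : ℝ => (θ : ℂ) ^ 5 * c θ) =o[nhds 0] fun θ : ℝ => θ ^ 4 := by
  have h1 : (fun θ : ℝ => (θ : ℂ) * c θ) =o[nhds 0] fun _ : ℝ => (1 : ℝ) := by
    rw [Asymptotics.isLittleO_one_iff]
    have : Continuous fun θ : ℝ => (θ : ℂ) * c θ := by fun_prop
    simpa using this.tendsto 0
  have h2 : (fun θ : ℝ => (θ : ℂ) ^ 4) =O[nhds 0] fun θ : ℝ => θ ^ 4 :=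
    Asymptotics.isBigO_of_le _ fun θ => by simp
  exact (h2.mul_isLittleO h1).congr (fun θ => by ring) fun θ => by ring

theorem exp_mul_I_sub_one_pow_isLittleO :
    ((fun θ : ℝ => (Complex.exp (θ * Complex.I) - 1) ^ 2 -
      (-(θ : ℂ) ^ 2 - Complex.I * θ ^ 3 + 7 / 12 * (θ : ℂ) ^ 4)) =o[nhds 0] fun θ : ℝ => θ ^ 4) ∧
    ((fun θ : ℝ => (Complex.exp (θ * Complex.I) - 1) ^ 3 -
      (-Complex.I * (θ : ℂ) ^ 3 + 3 / 2 * (θ : ℂ) ^ 4)) =o[nhds 0] fun θ : ℝ => θ ^ 4) ∧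
    ((fun θ : ℝ => (Complex.exp (θ * Complex.I) - 1) ^ 4 - (θ : ℂ) ^ 4)
      =o[nhds 0] fun θ : ℝ => θ ^ 4) ∧
    ((fun θ : ℝ => (Complex.exp (θ * Complex.I) - 1) ^ 5) =o[nhds 0] fun θ : ℝ => θ ^ 4) := by
  set z : ℝ → ℂ := fun θ => Complex.exp (θ * Complex.I) - 1 with hz
  have hzc : Continuous z := by fun_prop
  have hE := exp_mul_I_sub_one_isLittleO
  have hmul : ∀ {f c : ℝ → ℂ}, f =o[nhds 0] (fun θ : ℝ => θ ^ 4) → Continuous c →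
      (fun θ => c θ * f θ) =o[nhds 0] fun θ : ℝ => θ ^ 4 := by
    intro f c hf hc
    have h1 : c =O[nhds 0] fun _ : ℝ => (1 : ℝ) := (hc.tendsto 0).isBigO_one ℝ
    simpa using h1.mul_isLittleO hf
  have h2 : (fun θ : ℝ => z θ ^ 2 - (-(θ : ℂ) ^ 2 - Complex.I * θ ^ 3 + 7 / 12 * (θ : ℂ) ^ 4))
      =o[nhds 0] fun θ : ℝ => θ ^ 4 := by
    refine ((hmul hE (c := fun θ => z θ + (Complex.I * θ - (θ : ℂ) ^ 2 / 2 -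
      Complex.I * θ ^ 3 / 6 + (θ : ℂ) ^ 4 / 24)) (by fun_prop)).add
      (pow_five_mul_isLittleO (c := fun θ => Complex.I / 4 - 5 / 72 * θ -
        Complex.I / 72 * θ ^ 2 + 1 / 576 * (θ : ℂ) ^ 3) (by fun_prop))).congr_left fun θ => ?_
    simp only [hz]
    linear_combination (-(θ : ℂ) ^ 2 + (θ : ℂ) ^ 4 / 3 - (θ : ℂ) ^ 6 / 36) * Complex.I_sq
  have h3 : (fun θ : ℝ => z θ ^ 3 - (-Complex.I * (θ : ℂ) ^ 3 + 3 / 2 * (θ : ℂ) ^ 4))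
      =o[nhds 0] fun θ : ℝ => θ ^ 4 := by
    refine ((hmul h2 hzc).add ((hmul hE (c := fun θ : ℝ => -(θ : ℂ) ^ 2 - Complex.I * θ ^ 3 +
      7 / 12 * (θ : ℂ) ^ 4) (by fun_prop)).add (pow_five_mul_isLittleO (c := fun θ =>
        Complex.I * (7 / 12 + 1 / 6 + 1 / 2) - (1 / 6 + 7 / 24 + 1 / 24) * θ -
        Complex.I * (7 / 72 + 1 / 24) * θ ^ 2 + 7 / 288 * (θ : ℂ) ^ 3)
        (by fun_prop)))).congr_left fun θ => ?_
    simp only [hz]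
    linear_combination ((θ : ℂ) ^ 4 - (θ : ℂ) ^ 6 / 6) * Complex.I_sq
  have h4 : (fun θ : ℝ => z θ ^ 4 - (θ : ℂ) ^ 4) =o[nhds 0] fun θ : ℝ => θ ^ 4 := by
    refine ((hmul h3 hzc).add ((hmul hE (c := fun θ : ℝ => -Complex.I * (θ : ℂ) ^ 3 +
      3 / 2 * (θ : ℂ) ^ 4) (by fun_prop)).add (pow_five_mul_isLittleO (c := fun θ =>
        Complex.I * (3 / 2 + 1 / 2) - (3 / 4 + 1 / 6) * θ - Complex.I * (1 / 24 + 1 / 4) * θ ^ 2 +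
        1 / 16 * (θ : ℂ) ^ 3) (by fun_prop)))).congr_left fun θ => ?_
    simp only [hz]
    linear_combination ((θ : ℂ) ^ 4 - (θ : ℂ) ^ 6 / 6) * Complex.I_sq
  refine ⟨h2, h3, h4, ?_⟩
  refine ((hmul h4 hzc).add ((hmul hE (c := fun θ : ℝ => (θ : ℂ) ^ 4) (by fun_prop)).add
    (pow_five_mul_isLittleO (c := fun θ => Complex.I - θ / 2 - Complex.I / 6 * θ ^ 2 +
        1 / 24 * (θ : ℂ) ^ 3) (by fun_prop)))).congr_left fun θ => ?_
  simp only [hz]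
  ring

theorem saddleExponent_isLittleO {ι : Type*} {l : Filter ι} {ρ : ι → ℝ} {ρ₀ : ℝ} (hρ₀ : 0 < ρ₀)
    (hρ : Tendsto ρ l (nhds ρ₀)) :
    (fun p : ι × ℝ => saddleExponent (ρ p.1) p.2 - (-(1 + 2 * ρ p.1) * (p.2 : ℂ) ^ 2 / 2 -
      Complex.I * (1 / 6 + ρ p.1 + ρ p.1 ^ 2) * p.2 ^ 3 +
      (1 / 24 + 7 / 12 * ρ p.1 + 3 / 2 * (ρ p.1 : ℂ) ^ 2 + ρ p.1 ^ 3) * p.2 ^ 4))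
      =o[l ×ˢ nhds (0 : ℝ)] fun p => p.2 ^ 4 := by
  have hmul : ∀ {f : ℝ → ℂ} {c : ι × ℝ → ℂ} {c₀ : ℂ}, f =o[nhds 0] (fun θ : ℝ => θ ^ 4) →
      Tendsto c (l ×ˢ nhds (0 : ℝ)) (nhds c₀) →
      (fun p => c p * f p.2) =o[l ×ˢ nhds (0 : ℝ)] fun p => p.2 ^ 4 := by
    intro f c c₀ hf hc
    simpa using (hc.isBigO_one ℝ).mul_isLittleO (hf.comp_tendsto tendsto_snd)
  have hρp : Tendsto (fun p : ι × ℝ => ρ p.1) (l ×ˢ nhds (0 : ℝ)) (nhds ρ₀) :=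
    hρ.comp tendsto_fst
  have hρc : Tendsto (fun p : ι × ℝ => (ρ p.1 : ℂ)) (l ×ˢ nhds (0 : ℝ)) (nhds ρ₀) :=
    (Complex.continuous_ofReal.tendsto ρ₀).comp hρp
  have hz : Tendsto (fun p : ι × ℝ => Complex.exp (p.2 * Complex.I) - 1) (l ×ˢ nhds (0 : ℝ))
      (nhds 0) := by
    have h1 : Continuous fun θ : ℝ => Complex.exp (θ * Complex.I) - 1 := by fun_prop
    have h2 : Tendsto (fun θ : ℝ => Complex.exp (θ * Complex.I) - 1) (nhds 0) (nhds 0) := by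
      simpa using h1.tendsto 0
    exact h2.comp tendsto_snd
  have hq : Tendsto (fun p : ι × ℝ => (ρ p.1 : ℂ) ^ 4 /
      (1 - ρ p.1 * (Complex.exp (p.2 * Complex.I) - 1))) (l ×ˢ nhds (0 : ℝ))
      (nhds ((ρ₀ : ℂ) ^ 4 / (1 - ρ₀ * 0))) :=
    (hρc.pow 4).div (tendsto_const_nhds.sub (hρc.mul hz)) (by simp)
  obtain ⟨h2, h3, h4, h5⟩ := exp_mul_I_sub_one_pow_isLittleO
  refine Asymptotics.IsLittleO.congr' ((((hmul exp_mul_I_sub_one_isLittleO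
    (tendsto_const_nhds (x := (1 : ℂ)))).add (hmul h2 hρc)).add (hmul h3 (hρc.pow 2))).add
    (hmul h4 (hρc.pow 3)) |>.add (hmul h5 hq)) ?_ EventuallyEq.rfl
  filter_upwards [hρp.eventually (lt_mem_nhds hρ₀)] with p hp
  have h0 := one_sub_mul_exp_sub_one_ne_zero hp p.2
  simp only [saddleExponent]
  generalize Complex.exp (p.2 * Complex.I) - 1 = z at h0 ⊢
  simp only [div_eq_mul_inv]
  linear_combination (-(z * (1 + ρ p.1 * z + (ρ p.1 * z) ^ 2 + (ρ p.1 * z) ^ 3))) *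
    mul_inv_cancel₀ h0

/-- The coefficient of `1 / n` in the expansion of `normalizedComposition n ρ`. -/
noncomputable def compositionCorrection (ρ : ℝ) : ℝ :=
  (3 * ((1 / 24 + 7 / 12 * ρ + 3 / 2 * ρ ^ 2 + ρ ^ 3) / (1 + 2 * ρ)) -
    15 / 2 * ((1 / 6 + ρ + ρ ^ 2) / (1 + 2 * ρ)) ^ 2) / (1 + 2 * ρ)

theorem tendsto_normalizedComposition {ρ₀ : ℝ} (hρ₀ : 0 < ρ₀) :
    Tendsto (fun p : ℕ × ℝ => (p.1 : ℝ) *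
      (√(2 * π * (p.1 * (1 + 2 * p.2))) * normalizedComposition p.1 p.2 - 1))
      (atTop ×ˢ nhds ρ₀) (nhds (compositionCorrection ρ₀)) := by
  set l : Filter (ℕ × ℝ) := atTop ×ˢ nhds ρ₀ with hl
  have hρ : Tendsto (fun p : ℕ × ℝ => p.2) l (nhds ρ₀) := tendsto_snd
  have hρc : Tendsto (fun p : ℕ × ℝ => (p.2 : ℂ)) l (nhds ρ₀) :=
    (Complex.continuous_ofReal.tendsto ρ₀).comp hρ
  have hn : Tendsto (fun p : ℕ × ℝ => (p.1 : ℝ)) l atTop :=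
    tendsto_natCast_atTop_atTop.comp tendsto_fst
  have hV : Tendsto (fun p : ℕ × ℝ => 1 + 2 * p.2) l (nhds (1 + 2 * ρ₀)) :=
    (hρ.const_mul 2).const_add 1
  have hVc : Tendsto (fun p : ℕ × ℝ => 1 + 2 * (p.2 : ℂ)) l (nhds (1 + 2 * ρ₀)) :=
    (hρc.const_mul 2).const_add 1
  have hV0 : (1 + 2 * ρ₀ : ℂ) ≠ 0 := by exact_mod_cast (by positivity : (1 + 2 * ρ₀ : ℝ) ≠ 0)
  have hpos : ∀ᶠ p in l, 0 < p.2 := hρ.eventually (lt_mem_nhds hρ₀)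
  have hN : Tendsto (fun p : ℕ × ℝ => (p.1 : ℝ) * (1 + 2 * p.2)) l atTop :=
    hn.atTop_mul_pos (by positivity) hV
  set a : ℕ × ℝ → ℂ := fun p => -Complex.I * (1 / 6 + p.2 + p.2 ^ 2) / (1 + 2 * p.2) with ha_def
  have ha : Tendsto a l (nhds (-Complex.I * (1 / 6 + ρ₀ + ρ₀ ^ 2) / (1 + 2 * ρ₀))) :=
    (((hρc.const_add _).add (hρc.pow 2)).const_mul _).div hVc hV0
  set b : ℂ → ℂ := fun ρ => (1 / 24 + 7 / 12 * ρ + 3 / 2 * ρ ^ 2 + ρ ^ 3) / (1 + 2 * ρ) with hb_def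
  have hb : Tendsto (fun p : ℕ × ℝ => b p.2) l (nhds (b ρ₀)) :=
    ((((hρc.const_mul _).const_add _).add ((hρc.pow 2).const_mul _)).add (hρc.pow 3)).div hVc hV0
  have hmain := tendsto_laplace_second_order (l := l) hN
    (F := fun p => (Set.Ioc (-π) π).indicator fun θ => Complex.exp (p.1 * saddleExponent p.2 θ))
    (g := fun _ _ => 1) (χ := fun p θ => saddleExponent p.2 θ / (1 + 2 * p.2)) (a := a)
    (b := b ρ₀) (g₀ := 1) (g₁ := 0) (g₂ := 0) (γ := 0) (G := 1)
    (c := 2 / π ^ 2 / (2 * ρ₀ + 3) ^ 2) (k := 0) ha ?_ ?_ ?_ ?_ (by positivity) ?_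
  · have hreal : Tendsto (fun p : ℕ × ℝ => ((p.1 * (1 + 2 * p.2) *
        (√(p.1 * (1 + 2 * p.2)) * (2 * π * normalizedComposition p.1 p.2) - √(2 * π)) : ℝ) : ℂ)) l
        (nhds ((√(2 * π) * (compositionCorrection ρ₀ * (1 + 2 * ρ₀)) : ℝ) : ℂ)) := by
      have hlim : ((√(2 * π) * (compositionCorrection ρ₀ * (1 + 2 * ρ₀)) : ℝ) : ℂ) =
          (√(2 * π) : ℂ) * (0 + 0 + 3 * 0 * (-Complex.I * (1 / 6 + ρ₀ + ρ₀ ^ 2) / (1 + 2 * ρ₀)) +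
            1 * (3 * b ρ₀ + 15 / 2 *
              (-Complex.I * (1 / 6 + ρ₀ + ρ₀ ^ 2) / (1 + 2 * ρ₀)) ^ 2)) := by
        rw [compositionCorrection, hb_def]
        push_cast
        field_simp
        rw [Complex.I_sq]
        ring
      rw [hlim]
      refine hmain.congr' ?_
      filter_upwards [hpos] with p hp
      rw [MeasureTheory.integral_indicator measurableSet_Ioc,
        ← intervalIntegral.integral_of_le (by linarith [Real.pi_pos]),
        ← normalizedComposition_eq_integral p.1 hp]
      push_cast
      ring
    have hreal' := ((Filter.tendsto_ofReal_iff).1 hreal).div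
      (hV.const_mul √(2 * π)) (by positivity)
    have e : √(2 * π) * (compositionCorrection ρ₀ * (1 + 2 * ρ₀)) / (√(2 * π) * (1 + 2 * ρ₀)) =
        compositionCorrection ρ₀ := by field_simp
    rw [e] at hreal'
    refine hreal'.congr' ?_
    filter_upwards [hpos] with p hp
    have h2 : √(2 * π) ^ 2 = 2 * π := Real.sq_sqrt (by positivity)
    have h3 : √(2 * π) * (1 + 2 * p.2) ≠ 0 := by positivity
    rw [Pi.div_apply, Real.sqrt_mul (x := 2 * π) (by positivity), div_eq_iff h3]
    linear_combination (-(p.1 * (1 + 2 * p.2) * √(p.1 * (1 + 2 * p.2)) *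
      normalizedComposition p.1 p.2)) * h2
  · intro p
    refine Measurable.indicator ?_ measurableSet_Ioc
    unfold saddleExponent
    fun_prop
  · filter_upwards [(hpos.prod_inl (nhds (0 : ℝ))), (tendsto_snd (f := l)).eventually
      (Ioo_mem_nhds (neg_lt_zero.2 Real.pi_pos) Real.pi_pos)] with p hp hθ
    rw [Set.indicator_of_mem (show p.2 ∈ Set.Ioc (-π) π from ⟨hθ.1, hθ.2.le⟩), one_mul]
    have : (1 + 2 * (p.1.2 : ℂ)) ≠ 0 := by
      exact_mod_cast (by positivity : (1 + 2 * p.1.2 : ℝ) ≠ 0)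
    push_cast
    field_simp
  · have hinv : (fun p : (ℕ × ℝ) × ℝ => (1 + 2 * (p.1.2 : ℂ))⁻¹) =O[l ×ˢ nhds (0 : ℝ)]
        fun _ => (1 : ℝ) := ((hVc.inv₀ hV0).comp tendsto_fst).isBigO_one ℝ
    have hbo : (fun p : (ℕ × ℝ) × ℝ => b p.1.2 - b ρ₀) =o[l ×ˢ nhds (0 : ℝ)]
        fun _ => (1 : ℝ) := by
      rw [Asymptotics.isLittleO_one_iff]
      simpa using (hb.comp tendsto_fst).sub_const (b ρ₀)
    have h4 : (fun p : (ℕ × ℝ) × ℝ => (p.2 : ℂ) ^ 4) =O[l ×ˢ nhds (0 : ℝ)]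
        fun p => p.2 ^ 4 := Asymptotics.isBigO_of_le _ fun p => by simp
    have h5 := (hinv.mul_isLittleO (saddleExponent_isLittleO hρ₀ hρ)).add (hbo.mul_isBigO h4)
    simp only [one_mul] at h5
    refine h5.congr' ?_ EventuallyEq.rfl
    filter_upwards [hpos.prod_inl (nhds (0 : ℝ))] with p hp
    have : (1 + 2 * (p.1.2 : ℂ)) ≠ 0 := by
      exact_mod_cast (by positivity : (1 + 2 * p.1.2 : ℝ) ≠ 0)
    simp only [ha_def, hb_def]
    field_simp
    ring
  · simp
  · filter_upwards [hpos, hρ.eventually (gt_mem_nhds (lt_add_one ρ₀))] with p hp hp1 θ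
    rw [pow_zero, mul_one, one_mul]
    by_cases hθ : θ ∈ Set.Ioc (-π) π
    · rw [Set.indicator_of_mem hθ]
      refine (norm_exp_mul_saddleExponent_le hp p.1 (abs_le.2 ⟨hθ.1.le, hθ.2⟩)).trans ?_
      refine Real.exp_le_exp.2 ?_
      have h1 : (1 + 2 * p.2) ^ 2 ≤ (2 * ρ₀ + 3) ^ 2 :=
        pow_le_pow_left₀ (by positivity) (by linarith) 2
      rw [neg_mul, neg_mul, neg_le_neg_iff]
      calc _ = 2 / π ^ 2 / (2 * ρ₀ + 3) ^ 2 / (1 + 2 * p.2) * (p.1 * θ ^ 2) *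
            (1 + 2 * p.2) ^ 2 := by field_simp
        _ ≤ 2 / π ^ 2 / (2 * ρ₀ + 3) ^ 2 / (1 + 2 * p.2) * (p.1 * θ ^ 2) *
            (2 * ρ₀ + 3) ^ 2 := by gcongr
        _ = _ := by field_simp
    · rw [Set.indicator_of_notMem hθ, norm_zero]
      positivity

/-- The exponential rate of the integrand for diagonal rook walks, centred at its saddle point. -/
noncomputable def rookPhase (d : ℕ) (s : ℝ) : ℝ :=
  (d + 1) * (Real.exp s - 1 - s) + (Real.exp (-s) - 1 + s)

theorem sq_div_two_le_rookPhase (d : ℕ) (s : ℝ) : s ^ 2 / 2 ≤ rookPhase d s := by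
  have h1 := Real.add_one_le_exp s
  have h2 := Real.add_one_le_exp (-s)
  have hd : (0 : ℝ) ≤ d := d.cast_nonneg
  have h3 : 0 ≤ d * (Real.exp s - 1 - s) := mul_nonneg hd (by linarith)
  rw [rookPhase]
  rcases le_total 0 s with hs | hs
  · have := Real.quadratic_le_exp_of_nonneg hs
    linarith
  · have := Real.quadratic_le_exp_of_nonneg (neg_nonneg.2 hs)
    rw [neg_sq] at this
    linarith

theorem rookPhase_isLittleO (d : ℕ) :
    (fun s : ℝ => rookPhase d s - ((d + 2) * s ^ 2 / 2 + d * s ^ 3 / 6 + (d + 2) * s ^ 4 / 24))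
      =o[nhds 0] fun s : ℝ => s ^ 4 := by
  have h := Real.exp_sub_sum_range_succ_isLittleO_pow 4
  have h2 := h.comp_tendsto (k := fun s : ℝ => -s) (by simpa using tendsto_neg (0 : ℝ))
  have h3 : (fun s : ℝ => Real.exp (-s) - ∑ i ∈ Finset.range (4 + 1), (-s) ^ i / (i.factorial : ℝ))
      =o[nhds 0] fun s : ℝ => s ^ 4 := h2.congr (fun _ => rfl) fun s => by
        simp only [Function.comp]
        ring
  refine ((h.const_mul_left ((d : ℝ) + 1)).add h3).congr_left fun s => ?_
  simp only [Finset.sum_range_succ, Finset.sum_range_zero, Nat.factorial, rookPhase]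
  push_cast
  ring

theorem one_lt_mul_exp {D s : ℝ} (hD : 0 < D) (hs : -Real.log D < s) : 1 < D * Real.exp s := by
  rw [← Real.exp_log hD, ← Real.exp_add, Real.one_lt_exp_iff]
  linarith

theorem image_mul_exp_sub_two_add_inv {c D : ℝ} (hc : 0 < c) (hD : 0 < D) :
    (fun s => c * (D * Real.exp s - 2 + (D * Real.exp s)⁻¹)) '' Set.Ioi (-Real.log D) =
      Set.Ioi 0 := by
  ext t
  constructor
  · rintro ⟨s, hs, rfl⟩
    have hq := one_lt_mul_exp hD hs
    have h1 : D * Real.exp s - 2 + (D * Real.exp s)⁻¹ =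
        (D * Real.exp s - 1) ^ 2 / (D * Real.exp s) := by
      field_simp
      ring
    have h2 : 0 < D * Real.exp s - 1 := by linarith
    simp only [Set.mem_Ioi, h1]
    positivity
  · intro ht
    have ht : 0 < t := ht
    set τ := t / c with hτ
    have hτ0 : 0 < τ := by positivity
    set w := √(τ ^ 2 + 4 * τ) with hw
    have hw2 : w ^ 2 = τ ^ 2 + 4 * τ := Real.sq_sqrt (by positivity)
    have hw0 : 0 < w := Real.sqrt_pos.2 (by positivity)
    set q := (2 + τ + w) / 2 with hq
    have hq0 : 0 < q := by positivity
    have hqD : D * Real.exp (Real.log (q / D)) = q := by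
      rw [Real.exp_log (by positivity)]
      field_simp
    refine ⟨Real.log (q / D), ?_, ?_⟩
    · rw [Set.mem_Ioi, Real.log_div hq0.ne' hD.ne']
      have : 0 < Real.log q := Real.log_pos (by rw [hq]; linarith)
      linarith
    · simp only [hqD]
      have hinv : q⁻¹ = (2 + τ - w) / 2 := by
        refine inv_eq_of_mul_eq_one_right ?_
        rw [hq]
        linear_combination (-1 / 4) * hw2
      rw [hinv, hq, hτ]
      field_simp
      ring

theorem rookWalkCount_diag_eq_integral_rookPhase (d : ℕ) {n : ℕ} (hn : 0 < n) :
    (rookWalkCount d (fun _ => n) : ℝ) = n * (((d : ℝ) + 1) ^ d) ^ n *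
      ∫ s in Set.Ioi (-Real.log (d + 1)), Real.exp (-(n * rookPhase d s)) *
        (normalizedComposition n ((d + 1) * Real.exp s - 1)⁻¹ ^ d *
          ((d + 1) * Real.exp s - ((d + 1) * Real.exp s)⁻¹)) := by
  have hn0 : (0 : ℝ) < n := by exact_mod_cast hn
  have hD : (0 : ℝ) < d + 1 := by positivity
  rw [rookWalkCount_diag_eq_integral, ← image_mul_exp_sub_two_add_inv hn0 hD,
    MeasureTheory.integral_image_eq_integral_abs_deriv_smul
      (f' := fun s => n * ((d + 1) * Real.exp s - ((d + 1) * Real.exp s)⁻¹)) measurableSet_Ioi]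
  · rw [← MeasureTheory.integral_const_mul]
    refine MeasureTheory.setIntegral_congr_fun measurableSet_Ioi fun s hs => ?_
    have hq := one_lt_mul_exp hD hs
    have hes : Real.exp (-(n * rookPhase d s)) = Real.exp s ^ (d * n) * Real.exp (n *
        (d + 2 - (d + 1) * Real.exp s - Real.exp (-s))) := by
      rw [← Real.exp_nat_mul, ← Real.exp_add, rookPhase]
      push_cast
      ring_nf
    have hexp : Real.exp (n * (d + 2 - (d + 1) * Real.exp s - Real.exp (-s))) =
        Real.exp (-(n * ((d + 1) * Real.exp s - 2 + ((d + 1) * Real.exp s)⁻¹))) *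
          (Real.exp (-(n * (((d + 1) * Real.exp s)⁻¹ - 1)))) ^ d := by
      rw [← Real.exp_nat_mul, ← Real.exp_add, Real.exp_neg s]
      congr 1
      have := Real.exp_pos s
      field_simp
      ring
    have hD' : (((d : ℝ) + 1) ^ d) ^ n * Real.exp s ^ (d * n) = ((d + 1) * Real.exp s) ^ (d * n) := by
      rw [← pow_mul, mul_pow]
    simp only [smul_eq_mul]
    rw [hes, hexp]
    generalize (d + 1) * Real.exp s = q at hq hD' ⊢
    have hq0 : 0 < q - 1 := by linarith
    have hinv : q⁻¹ < q := (inv_lt_one_of_one_lt₀ hq).trans hq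
    rw [abs_of_pos (mul_pos hn0 (by linarith)), normalizedComposition]
    have h1 : (n : ℝ) / ((q - 1)⁻¹ * (1 + (q - 1)⁻¹)) = n * (q - 2 + q⁻¹) := by
      field_simp
      ring
    have h2 : (q - 1)⁻¹ / (1 + (q - 1)⁻¹) = q⁻¹ := by
      field_simp
      ring
    have h3 : -((n : ℝ) / (1 + (q - 1)⁻¹)) = n * (q⁻¹ - 1) := by
      field_simp
      ring
    rw [h1, h2, h3, mul_pow, mul_pow, Real.exp_neg (n * (q⁻¹ - 1))]
    have h4 : (q⁻¹ ^ n) ^ d * q ^ (d * n) = 1 := by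
      rw [← pow_mul, mul_comm n d, ← mul_pow, inv_mul_cancel₀ (by positivity), one_pow]
    have h5 : (Real.exp (n * (q⁻¹ - 1)))⁻¹ ^ d * Real.exp (n * (q⁻¹ - 1)) ^ d = 1 := by
      rw [← mul_pow, inv_mul_cancel₀ (Real.exp_pos _).ne', one_pow]
    rw [← hD'] at h4
    generalize Polynomial.eval (n * (q - 2 + q⁻¹)) (compositionPoly n) = P
    generalize Real.exp (-(n * (q - 2 + q⁻¹))) = E
    generalize (Real.exp (n * (q⁻¹ - 1)))⁻¹ ^ d = E1 at h5 ⊢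
    generalize Real.exp (n * (q⁻¹ - 1)) ^ d = E2 at h5 ⊢
    linear_combination (-(n * (q - q⁻¹) * E * P ^ d)) * h4 -
      (n * (q - q⁻¹) * E * P ^ d * ((q⁻¹ ^ n) ^ d * ((((d : ℝ) + 1) ^ d) ^ n *
        Real.exp s ^ (d * n)))) * h5
  · intro s _
    have h1 : HasDerivAt (fun s => ((d : ℝ) + 1) * Real.exp s) ((d + 1) * Real.exp s) s :=
      (Real.hasDerivAt_exp s).const_mul _
    have h2 : ((d : ℝ) + 1) * Real.exp s ≠ 0 := by positivity
    have h3 : (n : ℝ) * ((d + 1) * Real.exp s - ((d + 1) * Real.exp s)⁻¹) =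
        n * ((d + 1) * Real.exp s + -((d + 1) * Real.exp s) / ((d + 1) * Real.exp s) ^ 2) := by
      field_simp
      ring
    simp only [h3]
    exact (((h1.sub_const 2).add (h1.inv h2)).const_mul (n : ℝ)).hasDerivWithinAt
  · intro s hs u hu hsu
    have hq := one_lt_mul_exp hD hs
    have hp := one_lt_mul_exp hD hu
    have h1 : ((d : ℝ) + 1) * Real.exp s = (d + 1) * Real.exp u := by
      have h2 := mul_left_cancel₀ hn0.ne' hsu
      generalize ((d : ℝ) + 1) * Real.exp s = q at hq h2 ⊢
      generalize ((d : ℝ) + 1) * Real.exp u = p at hp h2 ⊢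
      have hq0 : q ≠ 0 := by positivity
      have hp0 : p ≠ 0 := by positivity
      have h3 : (q - p) * (q * p - 1) = 0 := by
        field_simp at h2
        linear_combination h2
      rcases mul_eq_zero.1 h3 with h | h
      · linarith
      · nlinarith
    exact Real.exp_injective (mul_left_cancel₀ hD.ne' h1)

theorem sub_quadratic_isLittleO_of_hasDerivAt {f f' : ℝ → ℝ} {f₂ : ℝ}
    (hf : ∀ᶠ x in nhds 0, HasDerivAt f (f' x) x) (hf' : HasDerivAt f' f₂ 0) :
    (fun x => f x - (f 0 + f' 0 * x + f₂ / 2 * x ^ 2)) =o[nhds 0] fun x => x ^ 2 := by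
  set φ : ℝ → ℝ := fun x => f x - (f 0 + f' 0 * x + f₂ / 2 * x ^ 2) with hφ
  refine Asymptotics.IsLittleO.of_bound fun ε hε => ?_
  have h1 := (hasDerivAt_iff_isLittleO.1 hf').def hε
  obtain ⟨δ, hδ, hball⟩ := Metric.eventually_nhds_iff_ball.1 (h1.and hf)
  filter_upwards [Metric.ball_mem_nhds (0 : ℝ) hδ] with x hx
  have hderiv : ∀ y ∈ Metric.closedBall (0 : ℝ) |x|,
      HasDerivWithinAt φ (f' y - f' 0 - f₂ * y) (Metric.closedBall (0 : ℝ) |x|) y := by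
    intro y hy
    have hyδ : y ∈ Metric.ball (0 : ℝ) δ := by
      rw [mem_closedBall_zero_iff, Real.norm_eq_abs] at hy
      rw [mem_ball_zero_iff, Real.norm_eq_abs] at hx ⊢
      exact hy.trans_lt hx
    have h2 := (hball y hyδ).2
    have h3 : HasDerivAt (fun x => f 0 + f' 0 * x + f₂ / 2 * x ^ 2)
        (f' 0 * 1 + f₂ / 2 * (↑(2 : ℕ) * y ^ (2 - 1) * 1)) y :=
      (((hasDerivAt_id y).const_mul (f' 0)).const_add (f 0)).add
        (((hasDerivAt_id y).pow 2).const_mul (f₂ / 2))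
    refine (h2.sub h3).hasDerivWithinAt.congr_deriv ?_
    push_cast
    ring
  have hbd : ∀ y ∈ Metric.closedBall (0 : ℝ) |x|, ‖f' y - f' 0 - f₂ * y‖ ≤ ε * |x| := by
    intro y hy
    rw [mem_closedBall_zero_iff, Real.norm_eq_abs] at hy
    have hyδ : y ∈ Metric.ball (0 : ℝ) δ := by
      rw [mem_ball_zero_iff, Real.norm_eq_abs] at hx ⊢
      exact hy.trans_lt hx
    have h2 := (hball y hyδ).1
    simp only [sub_zero, smul_eq_mul] at h2
    rw [mul_comm f₂ y]
    refine h2.trans ?_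
    rw [Real.norm_eq_abs]
    gcongr
  have h4 := (convex_closedBall (0 : ℝ) |x|).norm_image_sub_le_of_norm_hasDerivWithin_le hderiv hbd
    (x := 0) (y := x) (by simp) (by simp)
  have h5 : φ 0 = 0 := by simp [hφ]
  rw [h5, sub_zero, sub_zero, Real.norm_eq_abs x, mul_assoc, ← pow_two] at h4
  rwa [norm_pow, Real.norm_eq_abs x]

/-- The logarithm of the amplitude of the integrand for diagonal rook walks. -/
noncomputable def rookLogAmplitude (d : ℕ) (s : ℝ) : ℝ :=
  (d / 2 + 1) * Real.log ((d + 1) * Real.exp s - 1) +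
    (1 - d / 2) * Real.log ((d + 1) * Real.exp s + 1) - Real.log ((d + 1) * Real.exp s)

theorem exp_rookLogAmplitude (d : ℕ) {s : ℝ} (hs : -Real.log (d + 1) < s) :
    Real.exp (rookLogAmplitude d s) * √(1 + 2 * ((d + 1) * Real.exp s - 1)⁻¹) ^ d =
      (d + 1) * Real.exp s - ((d + 1) * Real.exp s)⁻¹ := by
  have hq := one_lt_mul_exp (by positivity) hs
  rw [rookLogAmplitude]
  generalize ((d : ℝ) + 1) * Real.exp s = q at hq ⊢
  have h1 : 0 < q - 1 := by linarith
  have h2 : 0 < q + 1 := by linarith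
  have h3 : 1 + 2 * (q - 1)⁻¹ = (q + 1) / (q - 1) := by
    field_simp
    ring
  have h4 : √((q + 1) / (q - 1)) ^ d =
      Real.exp (d / 2 * (Real.log (q + 1) - Real.log (q - 1))) := by
    rw [← Real.log_div h2.ne' h1.ne', Real.sqrt_eq_rpow, Real.rpow_def_of_pos (by positivity),
      ← Real.exp_nat_mul]
    ring_nf
  have h5 : q - q⁻¹ = (q - 1) * (q + 1) / q := by
    field_simp
    ring
  rw [h3, h4, h5, ← Real.exp_add]
  rw [show (d / 2 + 1) * Real.log (q - 1) + (1 - d / 2) * Real.log (q + 1) - Real.log q +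
    d / 2 * (Real.log (q + 1) - Real.log (q - 1)) =
    Real.log (q - 1) + Real.log (q + 1) - Real.log q by ring, Real.exp_sub, Real.exp_add,
    Real.exp_log h1, Real.exp_log h2, Real.exp_log (by positivity)]

theorem hasDerivAt_rookLogAmplitude (d : ℕ) {s : ℝ} (hs : -Real.log (d + 1) < s) :
    HasDerivAt (rookLogAmplitude d)
      ((d / 2 + 1) * ((d + 1) * Real.exp s / ((d + 1) * Real.exp s - 1)) +
        (1 - d / 2) * ((d + 1) * Real.exp s / ((d + 1) * Real.exp s + 1)) - 1) s := by
  have hq := one_lt_mul_exp (by positivity) hs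
  have h1 : HasDerivAt (fun s => ((d : ℝ) + 1) * Real.exp s) ((d + 1) * Real.exp s) s :=
    (Real.hasDerivAt_exp s).const_mul _
  have h2 := ((((h1.sub_const 1).log (by linarith)).const_mul (d / 2 + 1 : ℝ)).add
    (((h1.add_const 1).log (by linarith)).const_mul (1 - d / 2 : ℝ))).sub (h1.log (by linarith))
  rw [div_self (by linarith)] at h2
  exact h2

theorem hasDerivAt_deriv_rookLogAmplitude {d : ℕ} (hd : 0 < d) :
    HasDerivAt (fun s => ((d : ℝ) / 2 + 1) * ((d + 1) * Real.exp s / ((d + 1) * Real.exp s - 1)) +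
        (1 - d / 2) * ((d + 1) * Real.exp s / ((d + 1) * Real.exp s + 1)) - 1)
      (-(d / 2 + 1) * (d + 1) / d ^ 2 + (1 - d / 2) * (d + 1) / (d + 2) ^ 2) 0 := by
  have hd0 : (0 : ℝ) < d := by exact_mod_cast hd
  have h1 : HasDerivAt (fun s => ((d : ℝ) + 1) * Real.exp s) ((d + 1) * Real.exp 0) 0 :=
    (Real.hasDerivAt_exp 0).const_mul _
  have h2 := (((h1.div (h1.sub_const 1) (by simp [hd0.ne'])).const_mul (d / 2 + 1 : ℝ)).add
    ((h1.div (h1.add_const 1) (by positivity)).const_mul (1 - d / 2 : ℝ))).sub_const 1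
  refine h2.congr_deriv ?_
  rw [Real.exp_zero, mul_one, add_sub_cancel_right, add_assoc (d : ℝ) 1 1, one_add_one_eq_two]
  field_simp
  ring

/-- The first logarithmic derivative at `0` of the amplitude for diagonal rook walks. -/
noncomputable def rookAmplitudeSlope (d : ℕ) : ℝ :=
  (d / 2 + 1) * ((d + 1) / d) + (1 - d / 2) * ((d + 1) / (d + 2)) - 1

/-- The second logarithmic derivative at `0` of the amplitude for diagonal rook walks. -/
noncomputable def rookAmplitudeCurvature (d : ℕ) : ℝ :=
  -(d / 2 + 1) * (d + 1) / d ^ 2 + (1 - d / 2) * (d + 1) / (d + 2) ^ 2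

theorem neg_log_natCast_add_one_neg {d : ℕ} (hd : 0 < d) : -Real.log ((d : ℝ) + 1) < 0 :=
  neg_lt_zero.2 (Real.log_pos (by linarith [(by exact_mod_cast hd : (0 : ℝ) < d)]))

theorem exp_rookLogAmplitude_isLittleO {d : ℕ} (hd : 0 < d) :
    (fun s => Real.exp (rookLogAmplitude d s) - (Real.exp (rookLogAmplitude d 0) +
      Real.exp (rookLogAmplitude d 0) * rookAmplitudeSlope d * s +
      Real.exp (rookLogAmplitude d 0) * (rookAmplitudeSlope d ^ 2 + rookAmplitudeCurvature d) / 2 *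
        s ^ 2)) =o[nhds 0] fun s => s ^ 2 := by
  set L : ℝ → ℝ := fun s => ((d : ℝ) / 2 + 1) *
    ((d + 1) * Real.exp s / ((d + 1) * Real.exp s - 1)) +
    (1 - d / 2) * ((d + 1) * Real.exp s / ((d + 1) * Real.exp s + 1)) - 1 with hL
  have hL0 : L 0 = rookAmplitudeSlope d := by
    simp only [hL, Real.exp_zero, mul_one, add_sub_cancel_right, rookAmplitudeSlope,
      add_assoc (d : ℝ) 1 1, one_add_one_eq_two]
  have hneg := neg_log_natCast_add_one_neg hd
  have h0 := (hasDerivAt_rookLogAmplitude d hneg).exp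
  have h := sub_quadratic_isLittleO_of_hasDerivAt
    (f := fun s => Real.exp (rookLogAmplitude d s))
    (f' := fun s => Real.exp (rookLogAmplitude d s) * L s)
    ((lt_mem_nhds hneg).mono fun s hs => (hasDerivAt_rookLogAmplitude d hs).exp)
    (h0.mul (hasDerivAt_deriv_rookLogAmplitude hd))
  refine h.congr_left fun s => ?_
  change _ - (_ + _ * L 0 * s + (_ * L 0 * L 0 + _ * rookAmplitudeCurvature d) / 2 * s ^ 2) = _
  rw [hL0]
  ring

theorem tendsto_mul_one_add_div_pow_sub_one {ι : Type*} {l : Filter ι} {N C : ι → ℝ} {C₀ : ℝ}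
    (hN : Tendsto N l atTop) (hC : Tendsto C l (nhds C₀)) (d : ℕ) :
    Tendsto (fun i => N i * ((1 + C i / N i) ^ d - 1)) l (nhds (d * C₀)) := by
  have h1 : Tendsto (fun i => 1 + C i / N i) l (nhds 1) := by
    simpa using (hC.div_atTop hN).const_add 1
  have h2 : Tendsto (fun i => (∑ k ∈ Finset.range d, (1 + C i / N i) ^ k) * C i) l
      (nhds ((∑ _k ∈ Finset.range d, (1 : ℝ)) * C₀)) := by
    refine Tendsto.mul (tendsto_finsetSum _ fun k _ => ?_) hC
    simpa using h1.pow k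
  simp only [Finset.sum_const, Finset.card_range, nsmul_eq_mul, mul_one] at h2
  refine h2.congr' ?_
  filter_upwards [hN.eventually_gt_atTop 0] with i hi
  rw [← geom_sum_mul, add_sub_cancel_left]
  field_simp

/-- The amplitude of the integrand for diagonal rook walks, at scale `n`. -/
noncomputable def rookAmplitude (d n : ℕ) (s : ℝ) : ℝ :=
  √(2 * π * n) ^ d * (normalizedComposition n ((d + 1) * Real.exp s - 1)⁻¹ ^ d *
    ((d + 1) * Real.exp s - ((d + 1) * Real.exp s)⁻¹))

theorem rookAmplitude_isLittleO {d : ℕ} (hd : 0 < d) :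
    (fun p : ℕ × ℝ => rookAmplitude d p.1 p.2 - (Real.exp (rookLogAmplitude d 0) +
      Real.exp (rookLogAmplitude d 0) * rookAmplitudeSlope d * p.2 +
      Real.exp (rookLogAmplitude d 0) * (rookAmplitudeSlope d ^ 2 + rookAmplitudeCurvature d) / 2 *
        p.2 ^ 2 + Real.exp (rookLogAmplitude d 0) * (d * compositionCorrection (d : ℝ)⁻¹) / p.1))
      =o[atTop ×ˢ nhds (0 : ℝ)] fun p => p.2 ^ 2 + ((p.1 : ℝ) * (d + 2))⁻¹ := by
  have hd0 : (0 : ℝ) < d := by exact_mod_cast hd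
  set l : Filter (ℕ × ℝ) := atTop ×ˢ nhds (0 : ℝ) with hl
  set H : ℝ → ℝ := fun s => Real.exp (rookLogAmplitude d s) with hH
  have hneg := neg_log_natCast_add_one_neg hd
  have hs : ∀ᶠ p in l, -Real.log ((d : ℝ) + 1) < p.2 := tendsto_snd.eventually (lt_mem_nhds hneg)
  have hn : Tendsto (fun p : ℕ × ℝ => (p.1 : ℝ)) l atTop :=
    tendsto_natCast_atTop_atTop.comp tendsto_fst
  set C : ℕ × ℝ → ℝ := fun p => (p.1 : ℝ) *
    (√(2 * π * (p.1 * (1 + 2 * ((d + 1) * Real.exp p.2 - 1)⁻¹))) *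
      normalizedComposition p.1 ((d + 1) * Real.exp p.2 - 1)⁻¹ - 1) with hC_def
  have hC : Tendsto C l (nhds (compositionCorrection (d : ℝ)⁻¹)) := by
    have hρ : Tendsto (fun s : ℝ => (((d : ℝ) + 1) * Real.exp s - 1)⁻¹) (nhds 0)
        (nhds (d : ℝ)⁻¹) := by
      have h1 : Continuous fun s : ℝ => ((d : ℝ) + 1) * Real.exp s - 1 := by fun_prop
      have h2 := h1.tendsto 0
      rw [Real.exp_zero, mul_one, add_sub_cancel_right] at h2
      exact h2.inv₀ hd0.ne'
    exact (tendsto_normalizedComposition (inv_pos.2 hd0)).comp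
      (tendsto_fst.prodMk (hρ.comp tendsto_snd))
  set E : ℕ × ℝ → ℝ := fun p => p.1 * ((1 + C p / p.1) ^ d - 1) with hE_def
  have hE : Tendsto E l (nhds (d * compositionCorrection (d : ℝ)⁻¹)) :=
    tendsto_mul_one_add_div_pow_sub_one hn hC d
  have hH0 : Tendsto (fun p : ℕ × ℝ => H p.2) l (nhds (H 0)) :=
    ((hasDerivAt_rookLogAmplitude d hneg).exp.continuousAt.tendsto).comp tendsto_snd
  have hsq : (fun p : ℕ × ℝ => p.2 ^ 2) =O[l] fun p => p.2 ^ 2 + ((p.1 : ℝ) * (d + 2))⁻¹ := by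
    refine Asymptotics.isBigO_of_le _ fun p => ?_
    have h1 : 0 ≤ ((p.1 : ℝ) * (d + 2))⁻¹ := by positivity
    rw [Real.norm_of_nonneg (sq_nonneg _), Real.norm_of_nonneg (by positivity)]
    linarith
  have hinv : (fun p : ℕ × ℝ => ((p.1 : ℝ))⁻¹) =O[l]
      fun p => p.2 ^ 2 + ((p.1 : ℝ) * (d + 2))⁻¹ := by
    refine Asymptotics.isBigO_of_le' (c := d + 2) _ fun p => ?_
    have h1 : 0 ≤ ((p.1 : ℝ) * (d + 2))⁻¹ := by positivity
    rw [Real.norm_of_nonneg (by positivity), Real.norm_of_nonneg (by positivity)]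
    have h2 : ((d : ℝ) + 2) * ((p.1 : ℝ) * (d + 2))⁻¹ = (p.1 : ℝ)⁻¹ := by
      rw [mul_inv]
      field_simp
    rw [mul_add, h2]
    have : 0 ≤ ((d : ℝ) + 2) * p.2 ^ 2 := by positivity
    linarith
  have ho1 := ((exp_rookLogAmplitude_isLittleO hd).comp_tendsto
    (tendsto_snd (f := (atTop : Filter ℕ)))).trans_isBigO hsq
  have ho2 : (fun p => H p.2 * E p - H 0 * (d * compositionCorrection (d : ℝ)⁻¹)) =o[l]
      fun _ => (1 : ℝ) := by
    rw [Asymptotics.isLittleO_one_iff]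
    simpa using (hH0.mul hE).sub_const (H 0 * (d * compositionCorrection (d : ℝ)⁻¹))
  have ho3 := (ho2.mul_isBigO hinv)
  simp only [one_mul] at ho3
  refine (ho1.add ho3).congr' ?_ EventuallyEq.rfl
  filter_upwards [hs, hn.eventually_gt_atTop 0] with p hp hp0
  have hq := one_lt_mul_exp (by positivity) hp
  have hV : 0 ≤ 1 + 2 * (((d : ℝ) + 1) * Real.exp p.2 - 1)⁻¹ := by
    have : 0 < ((d : ℝ) + 1) * Real.exp p.2 - 1 := by linarith
    positivity
  have hamp : rookAmplitude d p.1 p.2 = H p.2 * (1 + E p / p.1) := by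
    have h1 : 1 + E p / p.1 = (1 + C p / p.1) ^ d := by
      simp only [hE_def]
      field_simp
      ring
    have h2 : 1 + C p / p.1 = √(2 * π * p.1) *
        √(1 + 2 * (((d : ℝ) + 1) * Real.exp p.2 - 1)⁻¹) *
        normalizedComposition p.1 ((d + 1) * Real.exp p.2 - 1)⁻¹ := by
      rw [← Real.sqrt_mul (by positivity), mul_assoc (2 * π)]
      simp only [hC_def]
      field_simp
      ring
    rw [h1, h2, rookAmplitude, ← exp_rookLogAmplitude d hp, mul_pow, mul_pow]
    ring
  simp only [hamp, Function.comp]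
  field_simp
  ring

theorem measurable_rookAmplitude (d n : ℕ) : Measurable (rookAmplitude d n) := by
  have h : Measurable fun x => (compositionPoly n).eval x :=
    (compositionPoly n).continuous.measurable
  unfold rookAmplitude normalizedComposition
  fun_prop

theorem abs_rookAmplitude_mul_exp_le (d : ℕ) {n : ℕ} (hn : 0 < n) {s : ℝ}
    (hs : -Real.log (d + 1) < s) :
    |rookAmplitude d n s * Real.exp (-(n * rookPhase d s))| ≤
      (2 * π) ^ d * (d + 1) * Real.exp 1 * n ^ d * Real.exp (-(n * s ^ 2 / 4)) := by
  have hn1 : (1 : ℝ) ≤ n := by exact_mod_cast hn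
  have hq := one_lt_mul_exp (by positivity) hs
  have hρ : 0 < (((d : ℝ) + 1) * Real.exp s - 1)⁻¹ := inv_pos.2 (by linarith)
  have hsqrt : √(2 * π * n) ^ d ≤ (2 * π) ^ d * n ^ d := by
    rw [← mul_pow]
    gcongr
    have h1 : 1 ≤ 2 * π * n := by nlinarith [Real.pi_gt_three]
    exact Real.sqrt_le_iff.2 ⟨by positivity, by nlinarith⟩
  have hcomp : |normalizedComposition n (((d : ℝ) + 1) * Real.exp s - 1)⁻¹| ^ d ≤ 1 :=
    pow_le_one₀ (abs_nonneg _) (abs_normalizedComposition_le_one n hρ)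
  have hfac : |((d : ℝ) + 1) * Real.exp s - (((d : ℝ) + 1) * Real.exp s)⁻¹| ≤
      (d + 1) * Real.exp s := by
    have h1 : (((d : ℝ) + 1) * Real.exp s)⁻¹ ≤ 1 := inv_le_one_of_one_le₀ hq.le
    have h2 : 0 ≤ (((d : ℝ) + 1) * Real.exp s)⁻¹ := by positivity
    rw [abs_of_nonneg (by linarith)]
    linarith
  have hexp : Real.exp s * Real.exp (-(n * rookPhase d s)) ≤
      Real.exp 1 * Real.exp (-(n * s ^ 2 / 4)) := by
    rw [← Real.exp_add, ← Real.exp_add, Real.exp_le_exp]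
    have h1 := mul_le_mul_of_nonneg_left (sq_div_two_le_rookPhase d s) (by positivity : (0 : ℝ) ≤ n)
    nlinarith [sq_nonneg (s - 2), mul_nonneg (sub_nonneg.2 hn1) (sq_nonneg s)]
  rw [rookAmplitude, abs_mul, abs_mul, abs_mul, abs_pow, abs_pow, Real.abs_exp,
    abs_of_nonneg (Real.sqrt_nonneg _)]
  calc _ ≤ (2 * π) ^ d * n ^ d * (1 * ((d + 1) * Real.exp s)) *
        Real.exp (-(n * rookPhase d s)) := by gcongr
    _ = (2 * π) ^ d * n ^ d * (d + 1) * (Real.exp s * Real.exp (-(n * rookPhase d s))) := by ring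
    _ ≤ (2 * π) ^ d * n ^ d * (d + 1) * (Real.exp 1 * Real.exp (-(n * s ^ 2 / 4))) := by gcongr
    _ = _ := by ring

theorem tendsto_integral_rookAmplitude {d : ℕ} (hd : 0 < d) :
    Tendsto (fun n : ℕ => ((n : ℝ) * (d + 2)) * (√((n : ℝ) * (d + 2)) *
        (∫ s in Set.Ioi (-Real.log ((d : ℝ) + 1)),
          rookAmplitude d n s * Real.exp (-(n * rookPhase d s))) -
        Real.exp (rookLogAmplitude d 0) * √(2 * π))) atTop
      (nhds (√(2 * π) * Real.exp (rookLogAmplitude d 0) *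
        ((rookAmplitudeSlope d ^ 2 + rookAmplitudeCurvature d) / 2 +
          d * compositionCorrection (d : ℝ)⁻¹ * (d + 2) -
          rookAmplitudeSlope d * (d / (2 * (d + 2))) - 1 / 8 +
          15 / 2 * (d / (6 * (d + 2))) ^ 2))) := by
  have hneg := neg_log_natCast_add_one_neg hd
  have hd2 : (0 : ℝ) < d + 2 := by positivity
  have hd2c : ((d : ℂ) + 2) ≠ 0 := by exact_mod_cast hd2.ne'
  set H : ℝ := Real.exp (rookLogAmplitude d 0) with hH
  set f : ℕ → ℝ → ℝ := fun n s => rookAmplitude d n s * Real.exp (-(n * rookPhase d s)) with hf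
  have hmain := tendsto_laplace_second_order (l := atTop) (N := fun n : ℕ => (n : ℝ) * (d + 2))
    (F := fun n => (Set.Ioi (-Real.log ((d : ℝ) + 1))).indicator fun s => (f n s : ℂ))
    (g := fun n s => (rookAmplitude d n s : ℂ))
    (χ := fun _ s => ((-rookPhase d s / (d + 2) : ℝ) : ℂ))
    (a := fun _ => ((-(d / (6 * (d + 2))) : ℝ) : ℂ)) (b := ((-1 / 24 : ℝ) : ℂ))
    (g₀ := (H : ℂ)) (g₁ := ((H * rookAmplitudeSlope d : ℝ) : ℂ))
    (g₂ := ((H * (rookAmplitudeSlope d ^ 2 + rookAmplitudeCurvature d) / 2 : ℝ) : ℂ))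
    (γ := ((H * (d * compositionCorrection (d : ℝ)⁻¹) * (d + 2) : ℝ) : ℂ))
    (G := (2 * π) ^ d * (d + 1) * Real.exp 1) (c := 1 / (4 * (d + 2))) (k := d)
    (tendsto_natCast_atTop_atTop.atTop_mul_const hd2) tendsto_const_nhds
    ?_ ?_ ?_ ?_ (by positivity) ?_
  · refine Filter.tendsto_ofReal_iff.1 ?_
    convert hmain using 2
    · rw [MeasureTheory.integral_indicator measurableSet_Ioi,
        integral_complex_ofReal]
      push_cast
      ring
    · push_cast
      field_simp
      ring
  · intro n
    refine Measurable.indicator ?_ measurableSet_Ioi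
    have := measurable_rookAmplitude d n
    simp only [hf]
    unfold rookPhase
    fun_prop
  · filter_upwards [tendsto_snd.eventually (lt_mem_nhds hneg)] with p hp
    rw [Set.indicator_of_mem (show p.2 ∈ Set.Ioi _ from hp)]
    simp only [hf]
    push_cast
    congr 2
    field_simp
  · have h1 := ((rookPhase_isLittleO d).const_mul_left (-((d : ℝ) + 2)⁻¹)).comp_tendsto
      (tendsto_snd (f := (atTop : Filter ℕ)) (g := nhds (0 : ℝ)))
    refine Asymptotics.IsLittleO.of_norm_left ?_
    refine h1.norm_left.congr_left fun p => ?_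
    rw [← Complex.norm_real]
    congr 1
    simp only [Function.comp]
    push_cast
    field_simp
    ring
  · refine Asymptotics.IsLittleO.of_norm_left ?_
    refine (rookAmplitude_isLittleO hd).norm_left.congr_left fun p => ?_
    rw [← Complex.norm_real]
    congr 1
    push_cast
    rw [mul_div_mul_right _ _ hd2c, hH, Complex.ofReal_exp]
  · filter_upwards [eventually_gt_atTop 0] with n hn s
    by_cases hs : s ∈ Set.Ioi (-Real.log ((d : ℝ) + 1))
    · rw [Set.indicator_of_mem hs, Complex.norm_real, Real.norm_eq_abs]
      refine (abs_rookAmplitude_mul_exp_le d hn hs).trans ?_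
      have e : -(1 / (4 * ((d : ℝ) + 2))) * (n * (d + 2) * s ^ 2) = -(n * s ^ 2 / 4) := by
        field_simp
      rw [e]
      gcongr
      exact le_mul_of_one_le_right (by positivity) (by linarith)
    · rw [Set.indicator_of_notMem hs, norm_zero]
      positivity

theorem exp_rookLogAmplitude_zero {d : ℕ} (hd : 0 < d) :
    Real.exp (rookLogAmplitude d 0) * √(((d : ℝ) + 2) / d) ^ d = d * (d + 2) / (d + 1) := by
  have hd0 : (0 : ℝ) < d := by exact_mod_cast hd
  have h := exp_rookLogAmplitude d (neg_log_natCast_add_one_neg hd)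
  rw [Real.exp_zero, mul_one, add_sub_cancel_right] at h
  have e : 1 + 2 * (d : ℝ)⁻¹ = (d + 2) / d := by field_simp
  rw [e] at h
  rw [h]
  field_simp
  ring

theorem rook_leading_term_normalization {d n : ℕ} (hd : 0 < d) (hn : 0 < n) :
    √((n : ℝ) * (d + 2)) * √(2 * π * n) ^ d *
        (√((d : ℝ) ^ (d + 2) / (((d : ℝ) + 2) ^ (d - 1) * ((d : ℝ) + 1) ^ 2 * 2 ^ (d - 1))) *
          ((n : ℝ) * π) ^ ((1 - (d : ℝ)) / 2)) =
      n * (Real.exp (rookLogAmplitude d 0) * √(2 * π)) := by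
  have hd0 : (0 : ℝ) < d := by exact_mod_cast hd
  have hn0 : (0 : ℝ) < n := by exact_mod_cast hn
  have hH : Real.exp (rookLogAmplitude d 0) ^ 2 =
      (d * (d + 2) / (d + 1)) ^ 2 * ((d : ℝ) / (d + 2)) ^ d := by
    rw [← exp_rookLogAmplitude_zero hd, mul_pow, ← pow_mul, mul_comm d 2, pow_mul,
      Real.sq_sqrt (by positivity), mul_assoc, ← mul_pow]
    have : ((d : ℝ) + 2) / d * (d / (d + 2)) = 1 := by field_simp
    rw [this, one_pow, mul_one]
  have hpow : (((n : ℝ) * π) ^ ((1 - (d : ℝ)) / 2)) ^ 2 = n * π / (n * π) ^ d := by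
    rw [← Real.rpow_natCast, ← Real.rpow_mul (by positivity), Nat.cast_ofNat,
      div_mul_cancel₀ _ two_ne_zero, Real.rpow_sub (by positivity), Real.rpow_one,
      Real.rpow_natCast]
  refine (pow_left_inj₀ (by positivity) (by positivity) two_ne_zero).1 ?_
  simp only [mul_pow, hH, hpow]
  rw [Real.sq_sqrt (by positivity), Real.sq_sqrt (by positivity), Real.sq_sqrt (by positivity),
    ← pow_mul, mul_comm d 2, pow_mul, Real.sq_sqrt (by positivity)]
  obtain ⟨m, rfl⟩ := Nat.exists_eq_succ_of_ne_zero hd.ne'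
  rw [Nat.succ_eq_add_one, Nat.add_sub_cancel]
  generalize ((m + 1 : ℕ) : ℝ) = x at hd0 ⊢
  simp only [mul_pow, div_pow, pow_succ, pow_zero, one_mul]
  field_simp

/-- Second-order asymptotics of diagonal `d`-dimensional rook walk numbers:
for fixed `d ≥ 2`, with `α_d = d^{d+2}/((d+2)^{d−1}(d+1)²2^{d−1})` and
`L_d(n) = √(α_d)·(nπ)^{(1−d)/2}·((d+1)^d)^n`, the quantity
`n·(a_d(n,…,n)/L_d(n) − 1)` tends to
`−(d−1)(d+1)(d³+6d²+18d+12)/(12d(d+2)³)` as `n → ∞`. -/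
theorem rook_diag_second_order_asymptotics (d : ℕ) (hd : 2 ≤ d) :
    Filter.Tendsto
      (fun n : ℕ =>
        (n : ℝ) *
          ((rookWalkCount d (fun _ => n) : ℝ) /
            (Real.sqrt ((d : ℝ) ^ (d + 2) /
                (((d : ℝ) + 2) ^ (d - 1) * ((d : ℝ) + 1) ^ 2 * 2 ^ (d - 1)))
              * ((n : ℝ) * Real.pi) ^ ((1 - (d : ℝ)) / 2)
              * (((d : ℝ) + 1) ^ d) ^ n) - 1))
      Filter.atTop
      (nhds (-(((d : ℝ) - 1) * ((d : ℝ) + 1) *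
          ((d : ℝ) ^ 3 + 6 * (d : ℝ) ^ 2 + 18 * (d : ℝ) + 12)) /
        (12 * (d : ℝ) * ((d : ℝ) + 2) ^ 3))) := by
  have hd0 : 0 < d := by omega
  have hd0' : (0 : ℝ) < d := by exact_mod_cast hd0
  have hmain := (tendsto_integral_rookAmplitude hd0).div_const
    ((d + 2) * (Real.exp (rookLogAmplitude d 0) * √(2 * π)))
  convert hmain.congr' ?_ using 2
  · unfold rookAmplitudeSlope rookAmplitudeCurvature compositionCorrection
    field_simp
    ring
  · filter_upwards [eventually_gt_atTop 0] with n hn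
    have hn0 : (0 : ℝ) < n := by exact_mod_cast hn
    have hnorm := rook_leading_term_normalization hd0 hn
    have hcount := rookWalkCount_diag_eq_integral_rookPhase d hn
    have hint : ∫ s in Set.Ioi (-Real.log ((d : ℝ) + 1)),
        rookAmplitude d n s * Real.exp (-(n * rookPhase d s)) =
        √(2 * π * n) ^ d * ∫ s in Set.Ioi (-Real.log ((d : ℝ) + 1)),
          Real.exp (-(n * rookPhase d s)) *
            (normalizedComposition n ((d + 1) * Real.exp s - 1)⁻¹ ^ d *
              ((d + 1) * Real.exp s - ((d + 1) * Real.exp s)⁻¹)) := by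
      rw [← MeasureTheory.integral_const_mul]
      refine MeasureTheory.integral_congr_ae (Eventually.of_forall fun s => ?_)
      simp only [rookAmplitude]
      ring
    rw [hint, hcount]
    set L := √((d : ℝ) ^ (d + 2) /
      (((d : ℝ) + 2) ^ (d - 1) * ((d : ℝ) + 1) ^ 2 * 2 ^ (d - 1))) *
        ((n : ℝ) * π) ^ ((1 - (d : ℝ)) / 2) with hL
    have hL0 : 0 < L := by positivity
    have hK : Real.exp (rookLogAmplitude d 0) * √(2 * π) =
        √((n : ℝ) * (d + 2)) * √(2 * π * n) ^ d * L / n := by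
      rw [hnorm]
      field_simp
    rw [hK]
    have h1 : 0 < √((n : ℝ) * (d + 2)) := by positivity
    have h2 : 0 < √(2 * π * n) := by positivity
    field_simp
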